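/- arXiv:1708.05669 — 9 statements merged into one kernel-verified Lean document; each statement's English description precedes it below -/
import Mathlib

section
/- For every n ≥ 0 the series ∑_{k=n}^{∞} U(n)(I−P)U(k+1)⁻¹ hₖ converges absolutely in H, and its norm is bounded uniformly in n: ‖∑_{k=n}^{∞} U(n)(I−P)U(k+1)⁻¹ hₖ‖ ≤ k₁ λ₁ (1−λ₁)⁻¹ · |||h|||. -/
/- For every n ≥ 0 the series ∑_{k=n}^{∞} U(n)(I−P)U(k+1)⁻¹ hₖ converges absolutely in H
   (index shift k = n + j), and its norm is bounded uniformly in n by k₁ λ₁ (1−λ₁)⁻¹ |||h|||. -/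
theorem bounded_tail_series_pos_axis
    {H : Type*} [NormedAddCommGroup H] [InnerProductSpace ℂ H] [CompleteSpace H]
    (A : ℤ → H →L[ℂ] H) (hA : ∃ C : ℝ, ∀ n : ℤ, ‖A n‖ ≤ C)
    (U : ℤ → H ≃L[ℂ] H)
    (hU0 : (U 0 : H →L[ℂ] H) = 1)
    (hUrec : ∀ n : ℤ, ((U (n + 1) : H →L[ℂ] H)) = (A n) ∘L (U n : H →L[ℂ] H))
    (h : ℤ → H) (Ch : ℝ) (hCh : ∀ n : ℤ, ‖h n‖ ≤ Ch)
    (P : H →L[ℂ] H) (hP : P ∘L P = P)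
    (k₁ l₁ : ℝ) (hk₁ : 1 ≤ k₁) (hl₁ : 0 < l₁) (hl₁one : l₁ < 1)
    (hdich₁ : ∀ m n : ℤ, 0 ≤ m → m ≤ n →
      ‖(U n : H →L[ℂ] H) ∘L P ∘L ((U m).symm : H →L[ℂ] H)‖ ≤ k₁ * l₁ ^ (n - m))
    (hdich₁p : ∀ m n : ℤ, 0 ≤ n → n ≤ m →
      ‖(U n : H →L[ℂ] H) ∘L (1 - P) ∘L ((U m).symm : H →L[ℂ] H)‖ ≤ k₁ * l₁ ^ (m - n)) :
    ∀ n : ℕ,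
      Summable (fun j : ℕ =>
        ‖(U (n : ℤ)) ((1 - P) ((U ((n : ℤ) + (j : ℤ) + 1)).symm (h ((n : ℤ) + (j : ℤ)))))‖) ∧
      ‖∑' j : ℕ, (U (n : ℤ)) ((1 - P) ((U ((n : ℤ) + (j : ℤ) + 1)).symm (h ((n : ℤ) + (j : ℤ)))))‖
        ≤ k₁ * l₁ * (1 - l₁)⁻¹ * Ch := by
  intro n
  have term_le : ∀ j : ℕ,
      ‖(U (n : ℤ)) ((1 - P) ((U ((n : ℤ) + (j : ℤ) + 1)).symm (h ((n : ℤ) + (j : ℤ)))))‖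
        ≤ k₁ * l₁ * Ch * l₁ ^ j := by
    intro j
    have hop := hdich₁p ((n : ℤ) + j + 1) n (by positivity) (by omega)
    have hexp : l₁ ^ ((n : ℤ) + j + 1 - n) = l₁ ^ j * l₁ := by
      rw [show (n : ℤ) + j + 1 - n = ((j + 1 : ℕ) : ℤ) by push_cast; ring, zpow_natCast, pow_succ]
    rw [hexp] at hop
    calc _ ≤ k₁ * (l₁ ^ j * l₁) * Ch :=
          ContinuousLinearMap.le_of_opNorm_le_of_le _ hop (hCh ((n : ℤ) + j))
      _ = k₁ * l₁ * Ch * l₁ ^ j := by ring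
  have hgeom := (hasSum_geometric_of_lt_one hl₁.le hl₁one).mul_left (k₁ * l₁ * Ch)
  refine ⟨Summable.of_nonneg_of_le (fun _ => norm_nonneg _) term_le hgeom.summable, ?_⟩
  exact (tsum_of_norm_bounded hgeom term_le).trans_eq (by ring)
end

section
/- For every ξ ∈ H, the sequence defined for n ≥ 0 by xₙ(ξ) = U(n)Pξ + ∑_{k=0}^{n−1} U(n) P U(k+1)⁻¹ hₖ − ∑_{k=n}^{∞} U(n)(I−P) U(k+1)⁻¹ hₖ satisfies x_{n+1}(ξ) = Aₙ xₙ(ξ) + hₙ for all n ≥ 0, and is bounded: sup_{n≥0} ‖xₙ(ξ)‖ < ∞. -/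
/- For every ξ ∈ H, the sequence xₙ(ξ) = U(n)Pξ + ∑_{k=0}^{n−1} U(n)PU(k+1)⁻¹hₖ −
   ∑_{k=n}^{∞} U(n)(I−P)U(k+1)⁻¹hₖ solves x_{n+1} = Aₙxₙ + hₙ on ℤ₊ and is bounded. -/
theorem general_solution_pos_axis
    {H : Type*} [NormedAddCommGroup H] [InnerProductSpace ℂ H] [CompleteSpace H]
    (A : ℤ → H →L[ℂ] H) (hA : ∃ C : ℝ, ∀ n : ℤ, ‖A n‖ ≤ C)
    (U : ℤ → H ≃L[ℂ] H)
    (hU0 : (U 0 : H →L[ℂ] H) = 1)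
    (hUrec : ∀ n : ℤ, ((U (n + 1) : H →L[ℂ] H)) = (A n) ∘L (U n : H →L[ℂ] H))
    (h : ℤ → H) (Ch : ℝ) (hCh : ∀ n : ℤ, ‖h n‖ ≤ Ch)
    (P : H →L[ℂ] H) (hP : P ∘L P = P)
    (k₁ l₁ : ℝ) (hk₁ : 1 ≤ k₁) (hl₁ : 0 < l₁) (hl₁one : l₁ < 1)
    (hdich₁ : ∀ m n : ℤ, 0 ≤ m → m ≤ n →
      ‖(U n : H →L[ℂ] H) ∘L P ∘L ((U m).symm : H →L[ℂ] H)‖ ≤ k₁ * l₁ ^ (n - m))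
    (hdich₁p : ∀ m n : ℤ, 0 ≤ n → n ≤ m →
      ‖(U n : H →L[ℂ] H) ∘L (1 - P) ∘L ((U m).symm : H →L[ℂ] H)‖ ≤ k₁ * l₁ ^ (m - n))
    (ξ : H) (x : ℕ → H)
    (hx : ∀ n : ℕ, x n =
      (U (n : ℤ)) (P ξ)
      + ∑ k ∈ Finset.range n, (U (n : ℤ)) (P ((U ((k : ℤ) + 1)).symm (h (k : ℤ))))
      - ∑' j : ℕ, (U (n : ℤ)) ((1 - P) ((U ((n : ℤ) + (j : ℤ) + 1)).symm (h ((n : ℤ) + (j : ℤ)))))) :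
    (∀ n : ℕ, x (n + 1) = A (n : ℤ) (x n) + h (n : ℤ)) ∧
    (∃ C : ℝ, ∀ n : ℕ, ‖x n‖ ≤ C) := by
  have hCh0 : 0 ≤ Ch := (norm_nonneg _).trans (hCh 0)
  have hstep : ∀ (n : ℤ) (v : H), A n (U n v) = U (n + 1) v := fun n v => by
    simpa using (DFunLike.congr_fun (hUrec n) v).symm
  have hstable : ∀ (n : ℕ), ∀ k ∈ Finset.range n,
      ‖U (n : ℤ) (P ((U ((k : ℤ) + 1)).symm (h (k : ℤ))))‖ ≤ k₁ * Ch * l₁ ^ (n - 1 - k) := by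
    intro n k hk
    have hkn : k < n := Finset.mem_range.mp hk
    have hb := ContinuousLinearMap.le_of_opNorm_le_of_le _
      (hdich₁ ((k : ℤ) + 1) n (by omega) (by omega)) (hCh k)
    rw [show (n : ℤ) - ((k : ℤ) + 1) = ((n - 1 - k : ℕ) : ℤ) by omega, zpow_natCast,
      mul_right_comm] at hb
    simpa only [ContinuousLinearMap.comp_apply, ContinuousLinearEquiv.coe_coe] using hb
  have hunstable : ∀ n j : ℕ,
      ‖U (n : ℤ) ((1 - P) ((U ((n : ℤ) + (j : ℤ) + 1)).symm (h ((n : ℤ) + (j : ℤ)))))‖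
        ≤ k₁ * Ch * l₁ ^ j := by
    intro n j
    have hb := ContinuousLinearMap.le_of_opNorm_le_of_le _
      (hdich₁p ((n : ℤ) + (j : ℤ) + 1) n (by omega) (by omega)) (hCh ((n : ℤ) + (j : ℤ)))
    rw [show (n : ℤ) + (j : ℤ) + 1 - n = ((j + 1 : ℕ) : ℤ) by push_cast; ring, zpow_natCast,
      mul_right_comm] at hb
    simp only [ContinuousLinearMap.comp_apply, ContinuousLinearEquiv.coe_coe] at hb
    refine hb.trans (mul_le_mul_of_nonneg_left ?_ (by positivity))
    exact pow_le_pow_of_le_one hl₁.le hl₁one.le j.le_succ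
  have hgeom : HasSum (fun j : ℕ => k₁ * Ch * l₁ ^ j) (k₁ * Ch * (1 - l₁)⁻¹) :=
    (hasSum_geometric_of_lt_one hl₁.le hl₁one).mul_left _
  have hsummable : ∀ n : ℕ, Summable fun j : ℕ =>
      U (n : ℤ) ((1 - P) ((U ((n : ℤ) + (j : ℤ) + 1)).symm (h ((n : ℤ) + (j : ℤ))))) :=
    fun n => Summable.of_norm_bounded hgeom.summable (hunstable n)
  refine ⟨fun n => ?_, k₁ * ‖ξ‖ + k₁ * Ch * (1 - l₁)⁻¹ + k₁ * Ch * (1 - l₁)⁻¹, fun n => ?_⟩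
  · have htail : A (n : ℤ) (∑' j : ℕ,
          U (n : ℤ) ((1 - P) ((U ((n : ℤ) + (j : ℤ) + 1)).symm (h ((n : ℤ) + (j : ℤ))))))
        = U ((n : ℤ) + 1) ((1 - P) ((U ((n : ℤ) + 1)).symm (h (n : ℤ))))
          + ∑' j : ℕ, U ((n : ℤ) + 1) ((1 - P)
            ((U ((n : ℤ) + 1 + (j : ℤ) + 1)).symm (h ((n : ℤ) + 1 + (j : ℤ))))) := by
      rw [(A (n : ℤ)).map_tsum (hsummable n),
        ((hsummable n).mapL (A (n : ℤ))).tsum_eq_zero_add]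
      simp only [hstep, Nat.cast_zero, add_zero, Nat.cast_add, Nat.cast_one]
      congr 1
      refine tsum_congr fun j => ?_
      rw [show (n : ℤ) + ((j : ℤ) + 1) = (n : ℤ) + 1 + (j : ℤ) by ring]
    have hsplit : U ((n : ℤ) + 1) ((1 - P) ((U ((n : ℤ) + 1)).symm (h (n : ℤ))))
        = h n - U ((n : ℤ) + 1) (P ((U ((n : ℤ) + 1)).symm (h (n : ℤ)))) := by
      simp
    rw [hx (n + 1), hx n, map_sub, map_add, map_sum, htail, hsplit, Finset.sum_range_succ]
    simp only [hstep, Nat.cast_add, Nat.cast_one]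
    abel
  · rw [hx n]
    refine (norm_sub_le _ _).trans (add_le_add ((norm_add_le _ _).trans (add_le_add ?_ ?_)) ?_)
    · have hU0symm : (U 0).symm ξ = ξ := by
        rw [ContinuousLinearEquiv.symm_apply_eq]
        simpa using (DFunLike.congr_fun hU0 ξ).symm
      have hb := ContinuousLinearMap.le_of_opNorm_le _ (hdich₁ 0 n le_rfl (by omega)) ξ
      simp only [ContinuousLinearMap.comp_apply, ContinuousLinearEquiv.coe_coe, hU0symm,
        sub_zero, zpow_natCast] at hb
      refine hb.trans (mul_le_mul_of_nonneg_right ?_ (norm_nonneg _))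
      exact mul_le_of_le_one_right (by positivity) (pow_le_one₀ hl₁.le hl₁one.le)
    · refine (norm_sum_le_of_le _ (hstable n)).trans ?_
      rw [Finset.sum_range_reflect (fun j => k₁ * Ch * l₁ ^ j) n]
      exact sum_le_hasSum _ (fun j _ => by positivity) hgeom
    · exact tsum_of_norm_bounded hgeom (hunstable n)
end

section
/- For every ξ ∈ H, the sequence defined for n ≤ 0 by xₙ(ξ) = U(n)(I−Q)ξ + ∑_{k=−∞}^{n−1} U(n) Q U(k+1)⁻¹ hₖ − ∑_{k=n}^{−1} U(n)(I−Q) U(k+1)⁻¹ hₖ satisfies x_{n+1}(ξ) = Aₙ xₙ(ξ) + hₙ for all n ≤ −1, and is bounded: sup_{n≤0} ‖xₙ(ξ)‖ < ∞. -/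
/- For every ξ ∈ H, the sequence xₙ(ξ) = U(n)(I−Q)ξ + ∑_{k=−∞}^{n−1} U(n)QU(k+1)⁻¹hₖ −
   ∑_{k=n}^{−1} U(n)(I−Q)U(k+1)⁻¹hₖ solves x_{n+1} = Aₙxₙ + hₙ for n ≤ −1 and is bounded on ℤ₋. -/
theorem general_solution_neg_axis
    {H : Type*} [NormedAddCommGroup H] [InnerProductSpace ℂ H] [CompleteSpace H]
    (A : ℤ → H →L[ℂ] H) (hA : ∃ C : ℝ, ∀ n : ℤ, ‖A n‖ ≤ C)
    (U : ℤ → H ≃L[ℂ] H)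
    (hU0 : (U 0 : H →L[ℂ] H) = 1)
    (hUrec : ∀ n : ℤ, ((U (n + 1) : H →L[ℂ] H)) = (A n) ∘L (U n : H →L[ℂ] H))
    (h : ℤ → H) (Ch : ℝ) (hCh : ∀ n : ℤ, ‖h n‖ ≤ Ch)
    (Q : H →L[ℂ] H) (hQ : Q ∘L Q = Q)
    (k₂ l₂ : ℝ) (hk₂ : 1 ≤ k₂) (hl₂ : 0 < l₂) (hl₂one : l₂ < 1)
    (hdich₂ : ∀ m n : ℤ, n ≤ 0 → m ≤ n →
      ‖(U n : H →L[ℂ] H) ∘L Q ∘L ((U m).symm : H →L[ℂ] H)‖ ≤ k₂ * l₂ ^ (n - m))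
    (hdich₂p : ∀ m n : ℤ, m ≤ 0 → n ≤ m →
      ‖(U n : H →L[ℂ] H) ∘L (1 - Q) ∘L ((U m).symm : H →L[ℂ] H)‖ ≤ k₂ * l₂ ^ (m - n))
    (ξ : H) (x : ℤ → H)
    (hx : ∀ n : ℤ, n ≤ 0 → x n =
      (U n) ((1 - Q) ξ)
      + ∑' j : ℕ, (U n) (Q ((U (n - (j : ℤ))).symm (h (n - 1 - (j : ℤ)))))
      - ∑ j ∈ Finset.range (-n).toNat,
          (U n) ((1 - Q) ((U (n + (j : ℤ) + 1)).symm (h (n + (j : ℤ)))))) :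
    (∀ n : ℤ, n ≤ -1 → x (n + 1) = A n (x n) + h n) ∧
    (∃ C : ℝ, ∀ n : ℤ, n ≤ 0 → ‖x n‖ ≤ C) := by
  have hCh0 : 0 ≤ Ch := (norm_nonneg _).trans (hCh 0)
  have hk0 : 0 ≤ k₂ := zero_le_one.trans hk₂
  have hstep (n : ℤ) (v : H) : U (n + 1) v = A n (U n v) := congrArg (fun T => T v) (hUrec n)
  have hpast (n : ℤ) (hn : n ≤ 0) (j : ℕ) :
      ‖U n (Q ((U (n - (j : ℤ))).symm (h (n - 1 - (j : ℤ)))))‖ ≤ k₂ * Ch * l₂ ^ j := by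
    have hb := hdich₂ (n - j) n hn (by omega)
    rw [sub_sub_cancel, zpow_natCast] at hb
    calc _ ≤ k₂ * l₂ ^ j * Ch :=
          ContinuousLinearMap.le_of_opNorm_le_of_le _ hb (hCh (n - 1 - (j : ℤ)))
      _ = _ := by ring
  have hfuture (n : ℤ) (j : ℕ) (hj : j < (-n).toNat) :
      ‖U n ((1 - Q) ((U (n + (j : ℤ) + 1)).symm (h (n + (j : ℤ)))))‖ ≤ k₂ * Ch * l₂ ^ j := by
    have hb := hdich₂p (n + j + 1) n (by omega) (by omega)
    rw [show n + (j : ℤ) + 1 - n = ((j + 1 : ℕ) : ℤ) by push_cast; ring, zpow_natCast] at hb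
    calc _ ≤ k₂ * l₂ ^ (j + 1) * Ch :=
          ContinuousLinearMap.le_of_opNorm_le_of_le _ hb (hCh (n + (j : ℤ)))
      _ ≤ k₂ * l₂ ^ j * Ch := by
          have := pow_le_pow_of_le_one hl₂.le hl₂one.le (Nat.le_succ j)
          gcongr
      _ = _ := by ring
  have hgeom : HasSum (fun j : ℕ => k₂ * Ch * l₂ ^ j) (k₂ * Ch * (1 - l₂)⁻¹) :=
    (hasSum_geometric_of_lt_one hl₂.le hl₂one).mul_left _
  have hsum (n : ℤ) (hn : n ≤ 0) :
      Summable fun j : ℕ => U n (Q ((U (n - (j : ℤ))).symm (h (n - 1 - (j : ℤ))))) :=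
    Summable.of_norm_bounded hgeom.summable (hpast n hn)
  constructor
  · intro n hn
    rw [hx n (by omega), hx (n + 1) (by omega), (hsum (n + 1) (by omega)).tsum_eq_zero_add,
      map_sub, map_add, (A n).map_tsum (hsum n (by omega)), map_sum,
      show (-n).toNat = (-(n + 1)).toNat + 1 by omega, Finset.sum_range_succ']
    simp only [← hstep]
    have e₁ (j : ℕ) : n + 1 - ((j + 1 : ℕ) : ℤ) = n - j := by push_cast; ring
    have e₂ (j : ℕ) : n - ((j + 1 : ℕ) : ℤ) = n - 1 - j := by push_cast; ring
    have e₃ (j : ℕ) : n + ((j + 1 : ℕ) : ℤ) = n + 1 + j := by push_cast; ring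
    simp only [e₁, e₂, e₃, Nat.cast_zero, sub_zero, add_zero, add_sub_cancel_right]
    have hsplit : U (n + 1) (Q ((U (n + 1)).symm (h n)))
        + U (n + 1) ((1 - Q) ((U (n + 1)).symm (h n))) = h n := by
      rw [← map_add]
      simp
    refine Eq.trans ?_ (congrArg (_ + ·) hsplit)
    abel
  · refine ⟨k₂ * ‖ξ‖ + k₂ * Ch * (1 - l₂)⁻¹ + k₂ * Ch * (1 - l₂)⁻¹, fun n hn => ?_⟩
    rw [hx n hn]
    refine (norm_sub_le _ _).trans (add_le_add ((norm_add_le _ _).trans (add_le_add ?_ ?_)) ?_)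
    · have hξ : (U 0).symm ξ = ξ := by
        rw [ContinuousLinearEquiv.symm_apply_eq]
        exact (congrArg (fun T => T ξ) hU0).symm
      have hb : ‖U n ((1 - Q) ((U 0).symm ξ))‖ ≤ k₂ * l₂ ^ (0 - n) * ‖ξ‖ :=
        ContinuousLinearMap.le_of_opNorm_le_of_le _ (hdich₂p 0 n le_rfl hn) le_rfl
      rw [hξ] at hb
      have hl : l₂ ^ (0 - n) ≤ 1 := zpow_le_one₀ hl₂ hl₂one.le (by omega)
      calc _ ≤ _ := hb
        _ ≤ k₂ * 1 * ‖ξ‖ := by gcongr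
        _ = _ := by ring
    · exact tsum_of_norm_bounded hgeom (hpast n hn)
    · calc _ ≤ ∑ j ∈ Finset.range (-n).toNat, k₂ * Ch * l₂ ^ j :=
            norm_sum_le_of_le _ fun j hj => hfuture n j (Finset.mem_range.mp hj)
        _ ≤ _ := sum_le_hasSum _ (fun j _ => by positivity) hgeom
end

section
/- Every bounded solution on ℤ₊ of the nonhomogeneous equation has the dichotomy representation: if x : ℕ → H satisfies x_{n+1} = Aₙ xₙ + hₙ for all n ≥ 0 and sup_{n≥0} ‖xₙ‖ < ∞, then for every n ≥ 0, xₙ = U(n) P x₀ + ∑_{k=0}^{n−1} U(n) P U(k+1)⁻¹ hₖ − ∑_{k=n}^{∞} U(n)(I−P) U(k+1)⁻¹ hₖ; in particular (I−P)x₀ = −∑_{k=0}^{∞} (I−P) U(k+1)⁻¹ hₖ. -/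
open Filter Topology

/-- Variation of constants: pulled back by the evolution operator, a solution of
`x (n + 1) = A n (x n) + h n` grows by the pulled back forcing terms. -/
theorem symm_solution_eq_add_sum {𝕜 E : Type*} [NontriviallyNormedField 𝕜]
    [NormedAddCommGroup E] [NormedSpace 𝕜 E] {A : ℤ → E →L[𝕜] E} {U : ℤ → E ≃L[𝕜] E}
    (hUrec : ∀ n : ℤ, (U (n + 1) : E →L[𝕜] E) = A n ∘L (U n : E →L[𝕜] E))
    {h : ℤ → E} {x : ℕ → E} (hsol : ∀ n : ℕ, x (n + 1) = A n (x n) + h n) (n m : ℕ) :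
    (U ((n + m : ℕ) : ℤ)).symm (x (n + m)) = (U (n : ℤ)).symm (x n)
      + ∑ j ∈ Finset.range m, (U ((n : ℤ) + (j : ℤ) + 1)).symm (h ((n : ℤ) + (j : ℤ))) := by
  induction m with
  | zero => simp
  | succ m ih =>
    rw [Finset.sum_range_succ, ← add_assoc (_ : E), ← ih, ← add_assoc, hsol]
    push_cast
    have key : (U ((n : ℤ) + m + 1)).symm (A ((n : ℤ) + m) (x (n + m)))
        = (U ((n : ℤ) + m)).symm (x (n + m)) := by
      rw [ContinuousLinearEquiv.symm_apply_eq]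
      have := DFunLike.congr_fun (hUrec ((n : ℤ) + m)) ((U ((n : ℤ) + m)).symm (x (n + m)))
      simpa using this.symm
    rw [map_add, key]

/-- Along a bounded solution, the forcing terms transported by an exponentially decaying backward
family `U n ∘ Q ∘ (U m)⁻¹` sum to the negative of the `Q`-component of the solution. -/
theorem hasSum_backward_of_bounded_solution {𝕜 E : Type*} [NontriviallyNormedField 𝕜]
    [NormedAddCommGroup E] [NormedSpace 𝕜 E] [CompleteSpace E]
    {A : ℤ → E →L[𝕜] E} {U : ℤ → E ≃L[𝕜] E}
    (hUrec : ∀ n : ℤ, (U (n + 1) : E →L[𝕜] E) = A n ∘L (U n : E →L[𝕜] E))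
    {h : ℤ → E} {Ch : ℝ} (hCh : ∀ n : ℤ, ‖h n‖ ≤ Ch) (Q : E →L[𝕜] E) {k l : ℝ}
    (hl : 0 < l) (hl_one : l < 1)
    (hQ : ∀ m n : ℤ, 0 ≤ n → n ≤ m →
      ‖(U n : E →L[𝕜] E) ∘L Q ∘L ((U m).symm : E →L[𝕜] E)‖ ≤ k * l ^ (m - n))
    {x : ℕ → E} (hsol : ∀ n : ℕ, x (n + 1) = A n (x n) + h n)
    {C : ℝ} (hC : ∀ n : ℕ, ‖x n‖ ≤ C) (n : ℕ) :
    HasSum (fun j : ℕ ↦ U (n : ℤ) (Q ((U ((n : ℤ) + (j : ℤ) + 1)).symm (h ((n : ℤ) + (j : ℤ))))))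
      (-U (n : ℤ) (Q ((U (n : ℤ)).symm (x n)))) := by
  have bound (j : ℕ) (v : E) (D : ℝ) (hv : ‖v‖ ≤ D) :
      ‖U (n : ℤ) (Q ((U ((n : ℤ) + (j : ℤ))).symm v))‖ ≤ k * l ^ j * D := by
    have hop := hQ ((n : ℤ) + j) n (by positivity) (by simp)
    rw [add_sub_cancel_left, zpow_natCast] at hop
    exact ContinuousLinearMap.le_of_opNorm_le_of_le _ hop hv
  have hsum : Summable fun j : ℕ ↦
      U (n : ℤ) (Q ((U ((n : ℤ) + (j : ℤ) + 1)).symm (h ((n : ℤ) + (j : ℤ))))) := by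
    refine Summable.of_norm_bounded (g := fun j : ℕ ↦ k * l ^ (j + 1) * Ch) ?_ fun j ↦ ?_
    · exact (((summable_nat_add_iff 1).2
        (summable_geometric_of_lt_one hl.le hl_one)).mul_left k).mul_right Ch
    · have := bound (j + 1) _ Ch (hCh ((n : ℤ) + j))
      rwa [Nat.cast_succ, ← add_assoc] at this
  have hlim : Tendsto (fun m : ℕ ↦ U (n : ℤ) (Q ((U ((n : ℤ) + (m : ℤ))).symm (x (n + m)))))
      atTop (𝓝 0) := by
    refine squeeze_zero_norm (fun m ↦ bound m _ C (hC _)) ?_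
    simpa using ((tendsto_pow_atTop_nhds_zero_of_lt_one hl.le hl_one).const_mul k).mul_const C
  have hpartial := hlim.sub_const (U (n : ℤ) (Q ((U (n : ℤ)).symm (x n))))
  rw [zero_sub] at hpartial
  refine (hsum.hasSum_iff_tendsto_nat).2 (hpartial.congr fun m ↦ ?_)
  have := symm_solution_eq_add_sum hUrec hsol n m
  rw [Nat.cast_add] at this
  simp [this]

/- Every bounded solution on ℤ₊ of the nonhomogeneous equation has the dichotomy representation,
   and in particular (I−P)x₀ = −∑_{k=0}^{∞}(I−P)U(k+1)⁻¹hₖ. -/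
theorem bounded_solution_representation_pos_axis
    {H : Type*} [NormedAddCommGroup H] [InnerProductSpace ℂ H] [CompleteSpace H]
    (A : ℤ → H →L[ℂ] H) (hA : ∃ C : ℝ, ∀ n : ℤ, ‖A n‖ ≤ C)
    (U : ℤ → H ≃L[ℂ] H)
    (hU0 : (U 0 : H →L[ℂ] H) = 1)
    (hUrec : ∀ n : ℤ, ((U (n + 1) : H →L[ℂ] H)) = (A n) ∘L (U n : H →L[ℂ] H))
    (h : ℤ → H) (Ch : ℝ) (hCh : ∀ n : ℤ, ‖h n‖ ≤ Ch)
    (P : H →L[ℂ] H) (hP : P ∘L P = P)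
    (k₁ l₁ : ℝ) (hk₁ : 1 ≤ k₁) (hl₁ : 0 < l₁) (hl₁one : l₁ < 1)
    (hdich₁ : ∀ m n : ℤ, 0 ≤ m → m ≤ n →
      ‖(U n : H →L[ℂ] H) ∘L P ∘L ((U m).symm : H →L[ℂ] H)‖ ≤ k₁ * l₁ ^ (n - m))
    (hdich₁p : ∀ m n : ℤ, 0 ≤ n → n ≤ m →
      ‖(U n : H →L[ℂ] H) ∘L (1 - P) ∘L ((U m).symm : H →L[ℂ] H)‖ ≤ k₁ * l₁ ^ (m - n))
    (x : ℕ → H)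
    (hsol : ∀ n : ℕ, x (n + 1) = A (n : ℤ) (x n) + h (n : ℤ))
    (hbd : ∃ C : ℝ, ∀ n : ℕ, ‖x n‖ ≤ C) :
    (∀ n : ℕ, x n =
      (U (n : ℤ)) (P (x 0))
      + ∑ k ∈ Finset.range n, (U (n : ℤ)) (P ((U ((k : ℤ) + 1)).symm (h (k : ℤ))))
      - ∑' j : ℕ, (U (n : ℤ)) ((1 - P) ((U ((n : ℤ) + (j : ℤ) + 1)).symm (h ((n : ℤ) + (j : ℤ)))))) ∧
    (1 - P) (x 0) = - ∑' k : ℕ, (1 - P) ((U ((k : ℤ) + 1)).symm (h (k : ℤ))) := by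
  obtain ⟨C, hC⟩ := hbd
  have hback := hasSum_backward_of_bounded_solution hUrec hCh (1 - P) hl₁ hl₁one hdich₁p hsol hC
  have hU0' (v : H) : U 0 v = v := DFunLike.congr_fun hU0 v
  have hU0symm (v : H) : (U 0).symm v = v := by
    rw [ContinuousLinearEquiv.symm_apply_eq, hU0']
  refine ⟨fun n ↦ ?_, ?_⟩
  · have hvar := symm_solution_eq_add_sum hUrec hsol 0 n
    simp only [zero_add, Nat.cast_zero, hU0symm] at hvar
    rw [(hback n).tsum_eq, sub_neg_eq_add, ← map_sum, ← map_sum, ← map_add, ← map_add P, ← hvar,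
      ← map_add]
    simp
  · have h0 := (hback 0).tsum_eq
    simp only [Nat.cast_zero, zero_add, hU0', hU0symm] at h0
    rw [h0, neg_neg]
end

section
/- (Theorem 1, existence criterion.) There exists a bounded sequence x : ℤ → H with x_{n+1} = Aₙ xₙ + hₙ for all n ∈ ℤ if and only if g lies in the range of the operator D, i.e. there exists ξ ∈ H with Dξ = g. -/
open Filter Topology Finset

section HalfLine

variable {E : Type*} [NormedAddCommGroup E] [NormedSpace ℂ E]

/-- If `y n = y 0 + ∑ k < n, c k` and `T (y n) → 0`, then `T (y 0)` is minus the sum of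
the `T (c k)`. -/
theorem apply_eq_neg_tsum_of_tendsto_zero {T : E →L[ℂ] E} {c : ℕ → E} {y : ℕ → E}
    (hy : ∀ n, y (n + 1) = y n + c n) (hc : Summable fun k => T (c k))
    (hT : Tendsto (fun n => T (y n)) atTop (𝓝 0)) :
    T (y 0) = -∑' k, T (c k) := by
  have hsum : ∀ n, T (y n) = T (y 0) + ∑ k ∈ range n, T (c k) := by
    intro n
    induction n with
    | zero => simp
    | succ n ih => rw [hy, map_add, ih, sum_range_succ, add_assoc]
  have hlim : Tendsto (fun n => T (y n)) atTop (𝓝 (T (y 0) + ∑' k, T (c k))) := by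
    rw [funext hsum]
    exact hc.hasSum.tendsto_sum_nat.const_add _
  exact eq_neg_of_add_eq_zero_left (tendsto_nhds_unique hlim hT)

/-- Boundedness on a half-line of the solution `V n (x₀ + ∑ k < n, c k)` whose unstable part
is minus the unstable part of the full series. -/
theorem norm_apply_add_sum_le [CompleteSpace E] {V : ℕ → E →L[ℂ] E} {R T : E →L[ℂ] E}
    (hRT : R + T = 1) {c : ℕ → E} {x₀ : E} {K K₀ l : ℝ} (hl : 0 ≤ l) (hl1 : l < 1) (hK : 0 ≤ K)
    (hs : ∀ n k, k < n → ‖V n (R (c k))‖ ≤ K * l ^ (n - 1 - k))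
    (hu : ∀ n k, ‖V n (T (c (k + n)))‖ ≤ K * l ^ k)
    (hc : Summable fun k => T (c k)) (hx₀ : T x₀ = -∑' k, T (c k))
    (hR : ∀ n, ‖V n (R x₀)‖ ≤ K₀) (n : ℕ) :
    ‖V n (x₀ + ∑ k ∈ range n, c k)‖ ≤ K₀ + K * (1 - l)⁻¹ + K * (1 - l)⁻¹ := by
  have hgeom := hasSum_geometric_of_lt_one hl hl1
  set y := x₀ + ∑ k ∈ range n, c k
  have hsplit : y = R y + T y := by
    rw [← add_apply, hRT, one_apply_eq_self]
  have hTy : T y = -∑' k, T (c (k + n)) := by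
    rw [map_add, hx₀, map_sum, ← hc.sum_add_tsum_nat_add n]
    abel
  have hstable : ‖V n (R y)‖ ≤ K₀ + K * (1 - l)⁻¹ := by
    rw [map_add, map_add, map_sum, map_sum]
    refine (norm_add_le _ _).trans (add_le_add (hR n) ?_)
    calc ‖∑ k ∈ range n, V n (R (c k))‖
        ≤ ∑ k ∈ range n, K * l ^ (n - 1 - k) :=
          norm_sum_le_of_le _ fun k hk => hs n k (mem_range.1 hk)
      _ = K * ∑ k ∈ range n, l ^ k := by
          rw [sum_range_reflect (fun k => K * l ^ k) n, mul_sum]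
      _ ≤ K * (1 - l)⁻¹ := by
          gcongr
          exact sum_le_hasSum _ (fun k _ => pow_nonneg hl k) hgeom
  have hunstable : ‖V n (T y)‖ ≤ K * (1 - l)⁻¹ := by
    rw [hTy, map_neg, norm_neg, (V n).map_tsum ((summable_nat_add_iff n).2 hc)]
    exact tsum_of_norm_bounded (hgeom.mul_left K) (hu n)
  rw [hsplit, map_add]
  exact (norm_add_le _ _).trans (add_le_add hstable hunstable)

theorem norm_apply_le_of_norm_comp_symm_le {V W : E ≃L[ℂ] E} {R : E →L[ℂ] E} {r C : ℝ}
    (hVW : ‖(V : E →L[ℂ] E) ∘L R ∘L (W.symm : E →L[ℂ] E)‖ ≤ r) {z : E} (hz : ‖z‖ ≤ C) :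
    ‖V (R (W.symm z))‖ ≤ r * C :=
  ContinuousLinearMap.le_of_opNorm_le_of_le _ hVW hz

end HalfLine

/- Theorem 1, existence criterion: a bounded solution on ℤ exists iff g ∈ range D. -/
theorem exists_bounded_solution_iff_mem_range
    {H : Type*} [NormedAddCommGroup H] [InnerProductSpace ℂ H] [CompleteSpace H]
    (A : ℤ → H →L[ℂ] H) (hA : ∃ C : ℝ, ∀ n : ℤ, ‖A n‖ ≤ C)
    (U : ℤ → H ≃L[ℂ] H)
    (hU0 : (U 0 : H →L[ℂ] H) = 1)
    (hUrec : ∀ n : ℤ, ((U (n + 1) : H →L[ℂ] H)) = (A n) ∘L (U n : H →L[ℂ] H))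
    (h : ℤ → H) (Ch : ℝ) (hCh : ∀ n : ℤ, ‖h n‖ ≤ Ch)
    (P : H →L[ℂ] H) (hP : P ∘L P = P)
    (k₁ l₁ : ℝ) (hk₁ : 1 ≤ k₁) (hl₁ : 0 < l₁) (hl₁one : l₁ < 1)
    (hdich₁ : ∀ m n : ℤ, 0 ≤ m → m ≤ n →
      ‖(U n : H →L[ℂ] H) ∘L P ∘L ((U m).symm : H →L[ℂ] H)‖ ≤ k₁ * l₁ ^ (n - m))
    (hdich₁p : ∀ m n : ℤ, 0 ≤ n → n ≤ m →
      ‖(U n : H →L[ℂ] H) ∘L (1 - P) ∘L ((U m).symm : H →L[ℂ] H)‖ ≤ k₁ * l₁ ^ (m - n))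
    (Q : H →L[ℂ] H) (hQ : Q ∘L Q = Q)
    (k₂ l₂ : ℝ) (hk₂ : 1 ≤ k₂) (hl₂ : 0 < l₂) (hl₂one : l₂ < 1)
    (hdich₂ : ∀ m n : ℤ, n ≤ 0 → m ≤ n →
      ‖(U n : H →L[ℂ] H) ∘L Q ∘L ((U m).symm : H →L[ℂ] H)‖ ≤ k₂ * l₂ ^ (n - m))
    (hdich₂p : ∀ m n : ℤ, m ≤ 0 → n ≤ m →
      ‖(U n : H →L[ℂ] H) ∘L (1 - Q) ∘L ((U m).symm : H →L[ℂ] H)‖ ≤ k₂ * l₂ ^ (m - n))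
    (D : H →L[ℂ] H) (hD : D = P - (1 - Q))
    (g : H)
    (hg : g = (∑' k : ℕ, (1 - P) ((U ((k : ℤ) + 1)).symm (h (k : ℤ))))
            + ∑' k : ℕ, Q ((U (-(k : ℤ))).symm (h (-1 - (k : ℤ))))) :
    (∃ x : ℤ → H, (∃ C : ℝ, ∀ n : ℤ, ‖x n‖ ≤ C) ∧ ∀ n : ℤ, x (n + 1) = A n (x n) + h n)
      ↔ ∃ ξ : H, D ξ = g := by
  have hCh0 : 0 ≤ Ch := (norm_nonneg _).trans (hCh 0)
  have hU0' : ∀ z, U 0 z = z := fun z => congrArg (fun F : H →L[ℂ] H => F z) hU0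
  have hU0s : ∀ z, (U 0).symm z = z := fun z => by rw [ContinuousLinearEquiv.symm_apply_eq, hU0']
  have hrec : ∀ n z, U (n + 1) z = A n (U n z) :=
    fun n z => congrArg (fun F : H →L[ℂ] H => F z) (hUrec n)
  set b : ℤ → H := fun k => (U (k + 1)).symm (h k) with hb
  have hbneg : ∀ k : ℕ, b (-1 - k) = (U (-(k : ℤ))).symm (h (-1 - k)) := by
    intro k
    simp only [hb]
    rw [show (-1 - (k : ℤ) + 1) = -k by ring]
  have hK₁ : 0 ≤ k₁ * Ch := by positivity
  have hK₂ : 0 ≤ k₂ * Ch := by positivity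
  have hstable₁ : ∀ n k : ℕ, k < n → ‖U n (P (b k))‖ ≤ k₁ * Ch * l₁ ^ (n - 1 - k) := by
    intro n k hk
    have := norm_apply_le_of_norm_comp_symm_le
      (hdich₁ ((k : ℤ) + 1) n (by omega) (by omega)) (hCh k)
    rw [show (n : ℤ) - (k + 1) = ((n - 1 - k : ℕ) : ℤ) by omega, zpow_natCast] at this
    exact this.trans_eq (by ring)
  have hunstable₁ : ∀ n k : ℕ, ‖U n ((1 - P) (b ↑(k + n)))‖ ≤ k₁ * Ch * l₁ ^ k := by
    intro n k
    have := norm_apply_le_of_norm_comp_symm_le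
      (hdich₁p (((k + n : ℕ) : ℤ) + 1) n (by omega) (by omega)) (hCh ↑(k + n))
    rw [show ((k + n : ℕ) : ℤ) + 1 - n = ((k + 1 : ℕ) : ℤ) by omega, zpow_natCast] at this
    calc _ ≤ _ := this
      _ = k₁ * Ch * l₁ ^ (k + 1) := by ring
      _ ≤ _ := mul_le_mul_of_nonneg_left
        (pow_le_pow_of_le_one hl₁.le hl₁one.le k.le_succ) hK₁
  have hstable₂ : ∀ n k : ℕ, k < n →
      ‖U (-(n : ℤ)) ((1 - Q) (b (-1 - k)))‖ ≤ k₂ * Ch * l₂ ^ (n - 1 - k) := by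
    intro n k hk
    have := norm_apply_le_of_norm_comp_symm_le
      (hdich₂p (-(k : ℤ)) (-n) (by omega) (by omega)) (hCh (-1 - k))
    rw [show -(k : ℤ) - -n = ((n - k : ℕ) : ℤ) by omega, zpow_natCast] at this
    rw [hbneg]
    calc _ ≤ _ := this
      _ = k₂ * Ch * l₂ ^ (n - k) := by ring
      _ ≤ _ := mul_le_mul_of_nonneg_left
        (pow_le_pow_of_le_one hl₂.le hl₂one.le (by omega)) hK₂
  have hunstable₂ : ∀ n k : ℕ,
      ‖U (-(n : ℤ)) (Q (b (-1 - ↑(k + n))))‖ ≤ k₂ * Ch * l₂ ^ k := by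
    intro n k
    have := norm_apply_le_of_norm_comp_symm_le
      (hdich₂ (-((k + n : ℕ) : ℤ)) (-n) (by omega) (by omega)) (hCh (-1 - ↑(k + n)))
    rw [show -(n : ℤ) - -((k + n : ℕ) : ℤ) = (k : ℤ) by omega, zpow_natCast] at this
    rw [hbneg]
    exact this.trans_eq (by ring)
  have hsum₁ : Summable fun k : ℕ => (1 - P) (b k) :=
    Summable.of_norm_bounded ((summable_geometric_of_lt_one hl₁.le hl₁one).mul_left (k₁ * Ch))
      fun k => by simpa [hU0'] using hunstable₁ 0 k
  have hsum₂ : Summable fun k : ℕ => Q (b (-1 - k)) :=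
    Summable.of_norm_bounded ((summable_geometric_of_lt_one hl₂.le hl₂one).mul_left (k₂ * Ch))
      fun k => by simpa [hU0'] using hunstable₂ 0 k
  have hg' : g = (∑' k : ℕ, (1 - P) (b k)) + ∑' k : ℕ, Q (b (-1 - k)) := by
    simp only [hg, hbneg]
    rfl
  constructor
  · rintro ⟨x, ⟨C, hC⟩, hx⟩
    have hy : ∀ n, (U (n + 1)).symm (x (n + 1)) = (U n).symm (x n) + b n := by
      intro n
      rw [ContinuousLinearEquiv.symm_apply_eq, map_add, hrec,
        ContinuousLinearEquiv.apply_symm_apply, ContinuousLinearEquiv.apply_symm_apply, hx]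
    have hlim : ∀ k l : ℝ, 0 < l → l < 1 →
        Tendsto (fun n : ℕ => k * l ^ n * C) atTop (𝓝 0) := fun k l hl hl1 => by
      simpa using ((tendsto_pow_atTop_nhds_zero_of_lt_one hl.le hl1).const_mul k).mul_const C
    have hpos := apply_eq_neg_tsum_of_tendsto_zero (T := 1 - P) (c := fun k : ℕ => b k)
      (y := fun n : ℕ => (U n).symm (x n)) (fun n => by simpa using hy n) hsum₁
      (squeeze_zero_norm (fun n => by
        simpa [hU0'] using norm_apply_le_of_norm_comp_symm_le
          (hdich₁p n 0 le_rfl (by omega)) (hC n)) (hlim k₁ l₁ hl₁ hl₁one))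
    have hneg := apply_eq_neg_tsum_of_tendsto_zero (T := Q) (c := fun k : ℕ => -b (-1 - k))
      (y := fun n : ℕ => (U (-(n : ℤ))).symm (x (-n)))
      (fun n => by
        have := hy (-1 - n)
        rw [show (-1 - (n : ℤ) + 1) = -n by ring] at this
        rw [this, show (-((n + 1 : ℕ) : ℤ)) = -1 - n by push_cast; ring]
        abel)
      (by simpa only [map_neg] using hsum₂.neg)
      (squeeze_zero_norm (fun n => by
        simpa [hU0'] using norm_apply_le_of_norm_comp_symm_le
          (hdich₂ (-n) 0 le_rfl (by omega)) (hC (-n))) (hlim k₂ l₂ hl₂ hl₂one))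
    simp only [map_neg, tsum_neg, neg_neg, Nat.cast_zero, neg_zero, hU0s] at hpos hneg
    refine ⟨x 0, ?_⟩
    rw [hg', ← hneg, ← neg_eq_iff_eq_neg.2 hpos, hD]
    simp only [sub_apply, one_apply_eq_self]
    abel
  · rintro ⟨ξ, hξ⟩
    have hPP : ∀ z, P (P z) = P z := fun z => congrArg (fun F : H →L[ℂ] H => F z) hP
    have hQQ : ∀ z, Q (Q z) = Q z := fun z => congrArg (fun F : H →L[ℂ] H => F z) hQ
    set S₁ := ∑' k : ℕ, (1 - P) (b k) with hS₁
    set S₂ := ∑' k : ℕ, Q (b (-1 - k)) with hS₂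
    have hPS₁ : P S₁ = 0 := by
      rw [hS₁, P.map_tsum hsum₁]
      simp [hPP]
    have hQS₂ : Q S₂ = S₂ := by
      rw [hS₂, Q.map_tsum hsum₂]
      simp [hQQ]
    obtain ⟨x₀, hx₀⟩ : ∃ x₀, x₀ = P ξ - S₁ := ⟨_, rfl⟩
    have hx₀' : x₀ = ξ - Q ξ + S₂ := by
      rw [hD, hg'] at hξ
      simp only [sub_apply, one_apply_eq_self] at hξ
      rw [hx₀, eq_sub_of_add_eq hξ.symm]
      abel
    have hPx₀ : (1 - P) x₀ = -S₁ := by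
      simp [hx₀, hPP, hPS₁]
    have hQx₀ : Q x₀ = S₂ := by
      simp [hx₀', hQQ, hQS₂]
    set y : ℤ → H := fun n =>
      x₀ + ∑ k ∈ range n.toNat, b k + ∑ k ∈ range (-n).toNat, -b (-1 - k) with hy
    have hyrec : ∀ n, y (n + 1) = y n + b n := by
      intro n
      obtain ⟨m, rfl | rfl⟩ : ∃ m : ℕ, n = m ∨ n = -1 - m := by
        rcases le_or_gt 0 n with hn | hn
        · exact ⟨n.toNat, by omega⟩
        · exact ⟨(-1 - n).toNat, by omega⟩
      · simp only [hy]
        rw [show ((m : ℤ) + 1).toNat = m + 1 by omega, show (-((m : ℤ) + 1)).toNat = 0 by omega,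
          show (m : ℤ).toNat = m by omega, show (-(m : ℤ)).toNat = 0 by omega, sum_range_succ]
        simp [add_assoc]
      · simp only [hy]
        rw [show (-1 - (m : ℤ) + 1).toNat = 0 by omega,
          show (-(-1 - (m : ℤ) + 1)).toNat = m by omega,
          show (-1 - (m : ℤ)).toNat = 0 by omega, show (-(-1 - (m : ℤ))).toNat = m + 1 by omega,
          sum_range_succ]
        abel
    have hpos := norm_apply_add_sum_le (V := fun n : ℕ => (U n : H →L[ℂ] H)) (R := P)
      (T := 1 - P) (K₀ := k₁ * ‖x₀‖) (x₀ := x₀) (c := fun k : ℕ => b k) (by abel)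
      hl₁.le hl₁one hK₁ hstable₁ hunstable₁ hsum₁ hPx₀ (fun n => by
        have := norm_apply_le_of_norm_comp_symm_le
          (hdich₁ 0 n le_rfl (by omega)) (le_refl ‖x₀‖)
        rw [hU0s, sub_zero, zpow_natCast] at this
        refine this.trans ?_
        gcongr
        exact mul_le_of_le_one_right (by positivity) (pow_le_one₀ hl₁.le hl₁one.le))
    have hneg := norm_apply_add_sum_le (V := fun n : ℕ => (U (-(n : ℤ)) : H →L[ℂ] H))
      (R := 1 - Q) (T := Q) (K₀ := k₂ * ‖x₀‖) (x₀ := x₀) (c := fun k : ℕ => -b (-1 - k))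
      (by abel) hl₂.le hl₂one hK₂
      (fun n k hk => by
        simpa only [map_neg, norm_neg, ContinuousLinearEquiv.coe_coe] using hstable₂ n k hk)
      (fun n k => by
        simpa only [map_neg, norm_neg, ContinuousLinearEquiv.coe_coe] using hunstable₂ n k)
      (by simpa only [map_neg] using hsum₂.neg)
      (by simpa only [map_neg, tsum_neg, neg_neg] using hQx₀) (fun n => by
        have := norm_apply_le_of_norm_comp_symm_le
          (hdich₂p 0 (-n) le_rfl (by omega)) (le_refl ‖x₀‖)
        rw [hU0s, sub_neg_eq_add, zero_add, zpow_natCast] at this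
        refine this.trans ?_
        gcongr
        exact mul_le_of_le_one_right (by positivity) (pow_le_one₀ hl₂.le hl₂one.le))
    refine ⟨fun n => U n (y n),
      ⟨max (k₁ * ‖x₀‖ + k₁ * Ch * (1 - l₁)⁻¹ + k₁ * Ch * (1 - l₁)⁻¹)
        (k₂ * ‖x₀‖ + k₂ * Ch * (1 - l₂)⁻¹ + k₂ * Ch * (1 - l₂)⁻¹), fun n => ?_⟩, fun n => ?_⟩
    · obtain ⟨m, rfl | rfl⟩ := n.eq_nat_or_neg
      · refine le_max_of_le_left ?_
        simpa [hy] using hpos m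
      · refine le_max_of_le_right ?_
        simpa [hy] using hneg m
    · beta_reduce
      rw [hyrec, map_add, hrec]
      simp [hb]
end

section
/- (Theorem 1, representation of the set of bounded solutions.) A bounded sequence x : ℤ → H satisfies x_{n+1} = Aₙ xₙ + hₙ for all n ∈ ℤ if and only if there exists ξ ∈ H with Dξ = g such that xₙ = U(n)Pξ + ∑_{k=0}^{n−1} U(n) P U(k+1)⁻¹ hₖ − ∑_{k=n}^{∞} U(n)(I−P) U(k+1)⁻¹ hₖ for all n ≥ 0 and xₙ = U(n)(I−Q)ξ + ∑_{k=−∞}^{n−1} U(n) Q U(k+1)⁻¹ hₖ − ∑_{k=n}^{−1} U(n)(I−Q) U(k+1)⁻¹ hₖ for all n ≤ 0. -/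
/-- The right-hand side of the representation formula on a half-line solves `z (n + 1) = z n + v n`. -/
theorem dichotomyFormula_succ {E : Type*} [NormedAddCommGroup E] [NormedSpace ℂ E]
    (P : E →L[ℂ] E) (v : ℕ → E) (hv : Summable fun k => (1 - P) (v k)) (ξ : E) (n : ℕ) :
    P ξ + ∑ k ∈ Finset.range (n + 1), P (v k) - ∑' j : ℕ, (1 - P) (v (n + 1 + j)) =
      (P ξ + ∑ k ∈ Finset.range n, P (v k) - ∑' j : ℕ, (1 - P) (v (n + j))) + v n := by
  have hs : Summable fun j => (1 - P) (v (n + j)) := by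
    simpa only [add_comm] using (summable_nat_add_iff n).2 hv
  rw [hs.tsum_eq_zero_add, Finset.sum_range_succ]
  simp only [add_zero, add_assoc, add_comm 1, sub_apply,
    one_apply_eq_self]
  abel

open Filter Topology in
/-- A solution of `y (n + 1) = y n + v n` whose complementary part tends to zero has
complementary initial value `-∑ (1 - P) v`. -/
theorem compl_initial_eq_neg_tsum {E : Type*} [NormedAddCommGroup E] [NormedSpace ℂ E]
    (P : E →L[ℂ] E) (v y : ℕ → E) (hv : Summable fun k => (1 - P) (v k))
    (hy : ∀ n, y (n + 1) = y n + v n)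
    (hlim : Tendsto (fun n => (1 - P) (y n)) atTop (𝓝 0)) :
    (1 - P) (y 0) = -∑' k, (1 - P) (v k) := by
  have hsum : ∀ n, (1 - P) (y n) = (1 - P) (y 0) + ∑ k ∈ Finset.range n, (1 - P) (v k) := by
    intro n
    induction n with
    | zero => simp
    | succ n ih => rw [hy, map_add, ih, Finset.sum_range_succ, add_assoc]
  have hlim' := hv.hasSum.tendsto_sum_nat.const_add ((1 - P) (y 0))
  exact eq_neg_of_add_eq_zero_left (tendsto_nhds_unique hlim' ((tendsto_congr hsum).1 hlim))

/-- A solution with the right complementary initial value is given by the representation formula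
on the half-line. -/
theorem eq_dichotomyFormula {E : Type*} [NormedAddCommGroup E] [NormedSpace ℂ E]
    (P : E →L[ℂ] E) (v y : ℕ → E) (hv : Summable fun k => (1 - P) (v k))
    (hy : ∀ n, y (n + 1) = y n + v n)
    (hy₀ : (1 - P) (y 0) = -∑' k, (1 - P) (v k)) (n : ℕ) :
    y n = P (y 0) + ∑ k ∈ Finset.range n, P (v k) - ∑' j : ℕ, (1 - P) (v (n + j)) := by
  induction n with
  | zero =>
    simp only [Finset.range_zero, Finset.sum_empty, add_zero, zero_add]
    rw [sub_eq_add_neg, ← hy₀]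
    simp
  | succ n ih => rw [dichotomyFormula_succ P v hv, ← ih, hy]

open Filter Topology in
/-- The representation of solutions on `ℤ` of `y (n + 1) = y n + v n`. -/
theorem solutions_representation {E : Type*} [NormedAddCommGroup E] [NormedSpace ℂ E]
    (P Q : E →L[ℂ] E) (v y : ℤ → E)
    (hv : Summable fun k : ℕ => (1 - P) (v k))
    (hv' : Summable fun k : ℕ => Q (v (-1 - k)))
    (hlim : Tendsto (fun n : ℕ => (1 - P) (y n)) atTop (𝓝 0))
    (hlim' : Tendsto (fun n : ℕ => Q (y (-n))) atTop (𝓝 0)) :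
    (∀ n : ℤ, y (n + 1) = y n + v n) ↔
    ∃ ξ : E, P ξ - (1 - Q) ξ = (∑' k : ℕ, (1 - P) (v k)) + ∑' k : ℕ, Q (v (-1 - k)) ∧
      (∀ n : ℕ, y n = P ξ + ∑ k ∈ Finset.range n, P (v k) - ∑' j : ℕ, (1 - P) (v (n + j))) ∧
      (∀ m : ℕ, y (-m) = (1 - Q) ξ + ∑' j : ℕ, Q (v (-m - 1 - j))
        - ∑ j ∈ Finset.range m, (1 - Q) (v (-m + j))) := by
  have hrefl : ∀ (ξ : E) (m : ℕ),
      (1 - Q) ξ + ∑' j : ℕ, Q (v (-m - 1 - j)) - ∑ j ∈ Finset.range m, (1 - Q) (v (-m + j)) =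
      (1 - Q) ξ + ∑ k ∈ Finset.range m, (1 - Q) (-v (-1 - k))
        - ∑' j : ℕ, (1 - (1 - Q)) (-v (-1 - (m + j : ℕ))) := by
    intro ξ m
    have hfin : ∑ j ∈ Finset.range m, (1 - Q) (v (-m + j)) =
        ∑ k ∈ Finset.range m, (1 - Q) (v (-1 - k)) := by
      rw [← Finset.sum_range_reflect]
      refine Finset.sum_congr rfl fun j hj => ?_
      have := Finset.mem_range.1 hj
      congr 2
      omega
    have htail : ∀ j : ℕ, (-m - 1 - j : ℤ) = -1 - (m + j : ℕ) := fun j => by push_cast; ring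
    simp only [hfin, htail, sub_sub_cancel, map_neg, tsum_neg, Finset.sum_neg_distrib]
    abel
  have hw : Summable fun k : ℕ => (1 - (1 - Q)) (-v (-1 - k)) := by
    simpa only [sub_sub_cancel, map_neg] using hv'.neg
  constructor
  · intro hy
    have hyP : ∀ n : ℕ, y ((n + 1 : ℕ) : ℤ) = y n + v n := fun n => by
      simpa using hy n
    have hyQ : ∀ n : ℕ, y (-(n + 1 : ℕ) : ℤ) = y (-n) + -v (-1 - n) := fun n => by
      have := hy (-1 - n)
      rw [show (-1 - n + 1 : ℤ) = -n by ring] at this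
      rw [this, show (-(n + 1 : ℕ) : ℤ) = -1 - n by push_cast; ring, add_neg_cancel_right]
    have hP₀ := compl_initial_eq_neg_tsum P (fun k => v k) (fun n => y n) hv hyP hlim
    have hQ₀ := compl_initial_eq_neg_tsum (1 - Q) (fun k => -v (-1 - k)) (fun n => y (-n)) hw hyQ
      (by simpa only [sub_sub_cancel] using hlim')
    refine ⟨y 0, ?_, fun n => ?_, fun m => ?_⟩
    · have hQ₁ : Q (y 0) = ∑' k : ℕ, Q (v (-1 - k)) := by
        simpa [sub_sub_cancel, tsum_neg] using hQ₀
      rw [← hQ₁, ← neg_neg (∑' k : ℕ, (1 - P) (v k)), ← hP₀]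
      simp only [sub_apply, one_apply_eq_self, Nat.cast_zero]
      abel
    · simpa using eq_dichotomyFormula P (fun k => v k) (fun n => y n) hv hyP hP₀ n
    · rw [hrefl]
      simpa using eq_dichotomyFormula (1 - Q) (fun k => -v (-1 - k)) (fun n => y (-n)) hw hyQ hQ₀ m
  · rintro ⟨ξ, -, hpos, hneg⟩ n
    rcases le_or_gt 0 n with hn | hn
    · lift n to ℕ using hn
      have hF := dichotomyFormula_succ P (fun k : ℕ => v k) hv ξ n
      have := hpos (n + 1)
      simp only [Nat.cast_add, Nat.cast_one] at hF this
      rw [this, hpos n, hF]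
    · obtain ⟨m, rfl⟩ : ∃ m : ℕ, n = -1 - m := ⟨(-1 - n).toNat, by omega⟩
      have hF := dichotomyFormula_succ (1 - Q) (fun k : ℕ => -v (-1 - k)) hw ξ m
      simp only [← hrefl] at hF
      rw [← hneg m, ← hneg (m + 1), show (-(m + 1 : ℕ) : ℤ) = -1 - m by push_cast; ring] at hF
      rw [hF, show (-1 - m + 1 : ℤ) = -m by ring, neg_add_cancel_right]

/- Theorem 1, representation of the set of bounded solutions. -/
theorem bounded_solutions_representation
    {H : Type*} [NormedAddCommGroup H] [InnerProductSpace ℂ H] [CompleteSpace H]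
    (A : ℤ → H →L[ℂ] H) (hA : ∃ C : ℝ, ∀ n : ℤ, ‖A n‖ ≤ C)
    (U : ℤ → H ≃L[ℂ] H)
    (hU0 : (U 0 : H →L[ℂ] H) = 1)
    (hUrec : ∀ n : ℤ, ((U (n + 1) : H →L[ℂ] H)) = (A n) ∘L (U n : H →L[ℂ] H))
    (h : ℤ → H) (Ch : ℝ) (hCh : ∀ n : ℤ, ‖h n‖ ≤ Ch)
    (P : H →L[ℂ] H) (hP : P ∘L P = P)
    (k₁ l₁ : ℝ) (hk₁ : 1 ≤ k₁) (hl₁ : 0 < l₁) (hl₁one : l₁ < 1)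
    (hdich₁ : ∀ m n : ℤ, 0 ≤ m → m ≤ n →
      ‖(U n : H →L[ℂ] H) ∘L P ∘L ((U m).symm : H →L[ℂ] H)‖ ≤ k₁ * l₁ ^ (n - m))
    (hdich₁p : ∀ m n : ℤ, 0 ≤ n → n ≤ m →
      ‖(U n : H →L[ℂ] H) ∘L (1 - P) ∘L ((U m).symm : H →L[ℂ] H)‖ ≤ k₁ * l₁ ^ (m - n))
    (Q : H →L[ℂ] H) (hQ : Q ∘L Q = Q)
    (k₂ l₂ : ℝ) (hk₂ : 1 ≤ k₂) (hl₂ : 0 < l₂) (hl₂one : l₂ < 1)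
    (hdich₂ : ∀ m n : ℤ, n ≤ 0 → m ≤ n →
      ‖(U n : H →L[ℂ] H) ∘L Q ∘L ((U m).symm : H →L[ℂ] H)‖ ≤ k₂ * l₂ ^ (n - m))
    (hdich₂p : ∀ m n : ℤ, m ≤ 0 → n ≤ m →
      ‖(U n : H →L[ℂ] H) ∘L (1 - Q) ∘L ((U m).symm : H →L[ℂ] H)‖ ≤ k₂ * l₂ ^ (m - n))
    (D : H →L[ℂ] H) (hD : D = P - (1 - Q))
    (g : H)
    (hg : g = (∑' k : ℕ, (1 - P) ((U ((k : ℤ) + 1)).symm (h (k : ℤ))))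
            + ∑' k : ℕ, Q ((U (-(k : ℤ))).symm (h (-1 - (k : ℤ)))))
    (x : ℤ → H) (hbd : ∃ C : ℝ, ∀ n : ℤ, ‖x n‖ ≤ C) :
    (∀ n : ℤ, x (n + 1) = A n (x n) + h n) ↔
    ∃ ξ : H, D ξ = g ∧
      (∀ n : ℕ, x (n : ℤ) =
        (U (n : ℤ)) (P ξ)
        + ∑ k ∈ Finset.range n, (U (n : ℤ)) (P ((U ((k : ℤ) + 1)).symm (h (k : ℤ))))
        - ∑' j : ℕ, (U (n : ℤ)) ((1 - P) ((U ((n : ℤ) + (j : ℤ) + 1)).symm (h ((n : ℤ) + (j : ℤ)))))) ∧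
      (∀ n : ℤ, n ≤ 0 → x n =
        (U n) ((1 - Q) ξ)
        + ∑' j : ℕ, (U n) (Q ((U (n - (j : ℤ))).symm (h (n - 1 - (j : ℤ)))))
        - ∑ j ∈ Finset.range (-n).toNat,
            (U n) ((1 - Q) ((U (n + (j : ℤ) + 1)).symm (h (n + (j : ℤ)))))) := by
 
  obtain ⟨C, hC⟩ := hbd
  have hsymm₀ : ∀ z, U 0 z = z := fun z => DFunLike.congr_fun hU0 z
  have hU : ∀ n z, U (n + 1) z = A n (U n z) := fun n z => DFunLike.congr_fun (hUrec n) z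
  have hbP : ∀ (m : ℕ) (z : H), ‖(1 - P) ((U m).symm z)‖ ≤ k₁ * l₁ ^ m * ‖z‖ := fun m z => by
    have := ContinuousLinearMap.le_of_opNorm_le _ (hdich₁p m 0 le_rfl (by simp)) z
    simpa only [ContinuousLinearMap.comp_apply, ContinuousLinearEquiv.coe_coe, hsymm₀, sub_zero,
      zpow_natCast] using this
  have hbQ : ∀ (m : ℕ) (z : H), ‖Q ((U (-m)).symm z)‖ ≤ k₂ * l₂ ^ m * ‖z‖ := fun m z => by
    have := ContinuousLinearMap.le_of_opNorm_le _ (hdich₂ (-m) 0 le_rfl (by simp)) z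
    simpa only [ContinuousLinearMap.comp_apply, ContinuousLinearEquiv.coe_coe, hsymm₀, sub_neg_eq_add,
      zero_add, zpow_natCast] using this
  have hgeo₁ := (summable_geometric_of_lt_one hl₁.le hl₁one).mul_left k₁
  have hgeo₂ := (summable_geometric_of_lt_one hl₂.le hl₂one).mul_left k₂
  have hvP : Summable fun k : ℕ => (1 - P) ((U ((k : ℤ) + 1)).symm (h k)) := by
    refine .of_norm_bounded (((summable_nat_add_iff 1).2 hgeo₁).mul_right Ch) fun k => ?_
    have := hbP (k + 1) (h k)
    push_cast at this
    exact this.trans (by gcongr; exact hCh k)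
  have hvQ : Summable fun k : ℕ => Q ((U (-1 - (k : ℤ) + 1)).symm (h (-1 - k))) := by
    refine .of_norm_bounded (hgeo₂.mul_right Ch) fun k => ?_
    rw [show (-1 - k + 1 : ℤ) = -k by ring]
    exact (hbQ k _).trans (by gcongr; exact hCh _)
  have hlimP : Filter.Tendsto (fun n : ℕ => (1 - P) ((U n).symm (x n))) Filter.atTop (nhds 0) :=
    squeeze_zero_norm (fun n => (hbP n _).trans (by gcongr; exact hC n))
      (hgeo₁.mul_right C).tendsto_atTop_zero
  have hlimQ : Filter.Tendsto (fun n : ℕ => Q ((U (-n)).symm (x (-n)))) Filter.atTop (nhds 0) :=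
    squeeze_zero_norm (fun n => (hbQ n _).trans (by gcongr; exact hC _))
      (hgeo₂.mul_right C).tendsto_atTop_zero
  have key := solutions_representation P Q (fun k => (U (k + 1)).symm (h k))
    (fun n => (U n).symm (x n)) hvP hvQ hlimP hlimQ
  have hrec : (∀ n : ℤ, (U (n + 1)).symm (x (n + 1)) =
      (U n).symm (x n) + (U (n + 1)).symm (h n)) ↔ ∀ n : ℤ, x (n + 1) = A n (x n) + h n := by
    refine forall_congr' fun n => ?_
    rw [ContinuousLinearEquiv.symm_apply_eq, map_add, hU, ContinuousLinearEquiv.apply_symm_apply,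
      ContinuousLinearEquiv.apply_symm_apply]
  rw [← hrec, key]
  have hidx : ∀ n j : ℤ, n - 1 - j + 1 = n - j := fun n j => by ring
  refine exists_congr fun ξ => and_congr ?_ (and_congr ?_ ?_)
  · have hidx₀ : ∀ k : ℤ, -1 - k + 1 = -k := fun k => by ring
    simp only [hidx₀, hD, hg, sub_apply]
  · refine forall_congr' fun n => ?_
    rw [ContinuousLinearEquiv.symm_apply_eq, map_sub, map_add, map_sum,
      ContinuousLinearEquiv.map_tsum]
  · have hcast : ∀ p : ℤ → Prop, (∀ n ≤ 0, p n) ↔ ∀ m : ℕ, p (-m) := fun p =>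
      ⟨fun hp m => hp _ (by simp), fun hp n hn => by
        simpa [Int.toNat_of_nonneg (neg_nonneg.2 hn)] using hp (-n).toNat⟩
    rw [hcast]
    refine forall_congr' fun m => ?_
    rw [ContinuousLinearEquiv.symm_apply_eq, map_sub, map_add, map_sum,
      ContinuousLinearEquiv.map_tsum]
    simp only [hidx, neg_neg, Int.toNat_natCast]
end

section
/- (Corollary on e-trichotomy.) Assume in addition that PQ = QP and PQ = Q. Then for every bounded sequence h : ℤ → H there exists a bounded sequence x : ℤ → H with x_{n+1} = Aₙ xₙ + hₙ for all n ∈ ℤ. -/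
/-- An inhomogeneous equation whose homogeneous part has an exponential dichotomy on `ℕ` has a
bounded solution starting in the kernel of the dichotomy projector. The solution is given in the
coordinates `z j = (V j)⁻¹ (x j)`. -/
theorem exists_bounded_solution_of_dichotomy_nat
    {H : Type*} [NormedAddCommGroup H] [NormedSpace ℂ H] [CompleteSpace H]
    (V : ℕ → H ≃L[ℂ] H) (P : H →L[ℂ] H) (hP : P ∘L P = P)
    (k l : ℝ) (hl : 0 < l) (hl1 : l < 1)
    (hs : ∀ m n : ℕ, m ≤ n →
      ‖(V n : H →L[ℂ] H) ∘L P ∘L ((V m).symm : H →L[ℂ] H)‖ ≤ k * l ^ (n - m))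
    (hu : ∀ m n : ℕ, n ≤ m →
      ‖(V n : H →L[ℂ] H) ∘L (1 - P) ∘L ((V m).symm : H →L[ℂ] H)‖ ≤ k * l ^ (m - n))
    (f : ℕ → H) (M : ℝ) (hf : ∀ n, ‖f n‖ ≤ M) :
    ∃ z : ℕ → H, (∃ C : ℝ, ∀ j, ‖V j (z j)‖ ≤ C) ∧
      (∀ j, z (j + 1) = z j + (V j).symm (f j)) ∧ P (z 0) = 0 := by
  have hk : 0 ≤ k := by simpa using (norm_nonneg _).trans (hs 0 0 le_rfl)
  have hM : 0 ≤ M := (norm_nonneg _).trans (hf 0)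
  set u : ℕ → H := fun m => (V m).symm (f m) with hu_def
  have hsu : ∀ m n : ℕ, m ≤ n → ‖V n (P (u m))‖ ≤ k * M * l ^ (n - m) := fun m n hmn => by
    have h1 := ContinuousLinearMap.le_of_opNorm_le_of_le _ (hs m n hmn) (hf m)
    calc _ ≤ k * l ^ (n - m) * M := h1
      _ = _ := by ring
  have huu : ∀ j i : ℕ, ‖V j ((1 - P) (u (i + j)))‖ ≤ k * M * l ^ i := fun j i => by
    have h1 := ContinuousLinearMap.le_of_opNorm_le_of_le _ (hu (i + j) j (by omega)) (hf (i + j))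
    calc _ ≤ k * l ^ (i + j - j) * M := h1
      _ = _ := by rw [Nat.add_sub_cancel]; ring
  have hgeo : HasSum (fun i : ℕ => k * M * l ^ i) (k * M * (1 - l)⁻¹) :=
    (hasSum_geometric_of_lt_one hl.le hl1).mul_left _
  have hVsum : ∀ j, Summable fun i => V j ((1 - P) (u (i + j))) := fun j =>
    Summable.of_norm_bounded hgeo.summable (huu j)
  have hsum : ∀ j, Summable fun i => (1 - P) (u (i + j)) := fun j =>
    (V j).summable.1 (hVsum j)
  refine ⟨fun j => ∑ m ∈ Finset.range j, P (u m) - ∑' i, (1 - P) (u (i + j)),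
    ⟨k * M * (1 - l)⁻¹ + k * M * (1 - l)⁻¹, fun j => ?_⟩, fun j => ?_, ?_⟩
  · rw [map_sub, map_sum, (V j).map_tsum]
    refine (norm_sub_le _ _).trans (add_le_add ?_ (tsum_of_norm_bounded hgeo (huu j)))
    calc _ ≤ ∑ m ∈ Finset.range j, k * M * l ^ (j - m) :=
          norm_sum_le_of_le _ fun m hm => hsu m j (Finset.mem_range.1 hm).le
      _ ≤ ∑ m ∈ Finset.range j, k * M * l ^ (j - 1 - m) := by
          refine Finset.sum_le_sum fun m _ => mul_le_mul_of_nonneg_left ?_ (by positivity)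
          exact pow_le_pow_of_le_one hl.le hl1.le (by omega)
      _ = ∑ m ∈ Finset.range j, k * M * l ^ m :=
          Finset.sum_range_reflect (fun m => k * M * l ^ m) j
      _ ≤ _ := sum_le_hasSum _ (fun i _ => by positivity) hgeo
  · have h1 := (hsum j).tsum_eq_zero_add
    have h2 : ∀ i, i + 1 + j = i + (j + 1) := fun i => by omega
    simp only [h2, zero_add] at h1
    dsimp only
    rw [h1, Finset.sum_range_succ]
    simp only [sub_apply, one_apply_eq_self, hu_def]
    abel
  · have h0 : ∀ y, P ((1 - P) y) = 0 := fun y => by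
      have := congrArg (fun T : H →L[ℂ] H => T y) hP
      simp only [ContinuousLinearMap.comp_apply] at this
      simp [this]
    simp only [Finset.range_zero, Finset.sum_empty, zero_sub, map_neg, P.map_tsum (hsum 0), h0,
      tsum_zero, neg_zero]


/- Corollary on e-trichotomy: if PQ = QP and PQ = Q then for every bounded h there is a
   bounded solution on ℤ. -/
theorem e_trichotomy_always_solvable
    {H : Type*} [NormedAddCommGroup H] [InnerProductSpace ℂ H] [CompleteSpace H]
    (A : ℤ → H →L[ℂ] H) (hA : ∃ C : ℝ, ∀ n : ℤ, ‖A n‖ ≤ C)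
    (U : ℤ → H ≃L[ℂ] H)
    (hU0 : (U 0 : H →L[ℂ] H) = 1)
    (hUrec : ∀ n : ℤ, ((U (n + 1) : H →L[ℂ] H)) = (A n) ∘L (U n : H →L[ℂ] H))
    (P : H →L[ℂ] H) (hP : P ∘L P = P)
    (k₁ l₁ : ℝ) (hk₁ : 1 ≤ k₁) (hl₁ : 0 < l₁) (hl₁one : l₁ < 1)
    (hdich₁ : ∀ m n : ℤ, 0 ≤ m → m ≤ n →
      ‖(U n : H →L[ℂ] H) ∘L P ∘L ((U m).symm : H →L[ℂ] H)‖ ≤ k₁ * l₁ ^ (n - m))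
    (hdich₁p : ∀ m n : ℤ, 0 ≤ n → n ≤ m →
      ‖(U n : H →L[ℂ] H) ∘L (1 - P) ∘L ((U m).symm : H →L[ℂ] H)‖ ≤ k₁ * l₁ ^ (m - n))
    (Q : H →L[ℂ] H) (hQ : Q ∘L Q = Q)
    (k₂ l₂ : ℝ) (hk₂ : 1 ≤ k₂) (hl₂ : 0 < l₂) (hl₂one : l₂ < 1)
    (hdich₂ : ∀ m n : ℤ, n ≤ 0 → m ≤ n →
      ‖(U n : H →L[ℂ] H) ∘L Q ∘L ((U m).symm : H →L[ℂ] H)‖ ≤ k₂ * l₂ ^ (n - m))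
    (hdich₂p : ∀ m n : ℤ, m ≤ 0 → n ≤ m →
      ‖(U n : H →L[ℂ] H) ∘L (1 - Q) ∘L ((U m).symm : H →L[ℂ] H)‖ ≤ k₂ * l₂ ^ (m - n))
    (hcomm : P ∘L Q = Q ∘L P) (hPQ : P ∘L Q = Q) :
    ∀ h : ℤ → H, (∃ C : ℝ, ∀ n : ℤ, ‖h n‖ ≤ C) →
      ∃ x : ℤ → H, (∃ C : ℝ, ∀ n : ℤ, ‖x n‖ ≤ C) ∧ ∀ n : ℤ, x (n + 1) = A n (x n) + h n := by
  rintro h ⟨M, hM⟩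
  obtain ⟨zp, ⟨Cp, hCp⟩, hzp, hPa⟩ := exists_bounded_solution_of_dichotomy_nat
    (fun j => U (j + 1)) P hP k₁ l₁ hl₁ hl₁one
    (fun m n hmn => by
      refine (hdich₁ (m + 1) (n + 1) (by omega) (by omega)).trans_eq ?_
      rw [← zpow_natCast]; congr 2; omega)
    (fun m n hmn => by
      refine (hdich₁p (m + 1) (n + 1) (by omega) (by omega)).trans_eq ?_
      rw [← zpow_natCast]; congr 2; omega)
    (fun j => h j) M (fun j => hM j)
  obtain ⟨zm, ⟨Cm, hCm⟩, hzm, hQb⟩ := exists_bounded_solution_of_dichotomy_nat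
    (fun j => U (-j)) (1 - Q)
    (show (1 - Q) * (1 - Q) = 1 - Q from IsIdempotentElem.one_sub hQ)
    k₂ l₂ hl₂ hl₂one
    (fun m n hmn => by
      refine (hdich₂p (-m) (-n) (by omega) (by omega)).trans_eq ?_
      rw [← zpow_natCast]; congr 2; omega)
    (fun m n hmn => by
      rw [sub_sub_cancel]
      refine (hdich₂ (-m) (-n) (by omega) (by omega)).trans_eq ?_
      rw [← zpow_natCast]; congr 2; omega)
    (fun j => -h (-j - 1)) M (fun j => by simpa using hM (-j - 1))
  have hPQ' : ∀ y, P (Q y) = Q y := fun y => congrArg (fun T : H →L[ℂ] H => T y) hPQ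
  have hQP' : ∀ y, Q (P y) = Q y := fun y =>
    congrArg (fun T : H →L[ℂ] H => T y) (hcomm.symm.trans hPQ)
  set a := zp 0
  set b := zm 0
  have hb : P b = b := by
    have hQb' : Q b = b := (sub_eq_zero.1 hQb).symm
    rw [← hQb', hPQ']
  have ha : (1 - Q) a = a := by
    have hQa : Q a = 0 := by rw [← hQP', hPa, map_zero]
    simp [hQa]
  have hU0' : (U 0).symm = ContinuousLinearEquiv.refl ℂ H := by
    have : U 0 = ContinuousLinearEquiv.refl ℂ H := ContinuousLinearEquiv.coe_injective hU0
    rw [this]; rfl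
  have hUb : ∀ j : ℕ, ‖U j b‖ ≤ k₁ * ‖b‖ := fun j => by
    have h1 := ContinuousLinearMap.le_of_opNorm_le _ (hdich₁ 0 j le_rfl (by omega)) b
    simp only [hU0', ContinuousLinearMap.comp_apply, ContinuousLinearEquiv.coe_coe,
      ContinuousLinearEquiv.refl_apply, hb] at h1
    refine h1.trans (mul_le_mul_of_nonneg_right ?_ (norm_nonneg _))
    rw [sub_zero, zpow_natCast]
    exact mul_le_of_le_one_right (by linarith) (pow_le_one₀ hl₁.le hl₁one.le)
  have hUa : ∀ j : ℕ, ‖U (-j) a‖ ≤ k₂ * ‖a‖ := fun j => by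
    have h1 := ContinuousLinearMap.le_of_opNorm_le _ (hdich₂p 0 (-j) le_rfl (by omega)) a
    simp only [hU0', ContinuousLinearMap.comp_apply, ContinuousLinearEquiv.coe_coe,
      ContinuousLinearEquiv.refl_apply, ha] at h1
    refine h1.trans (mul_le_mul_of_nonneg_right ?_ (norm_nonneg _))
    rw [zero_sub, neg_neg, zpow_natCast]
    exact mul_le_of_le_one_right (by linarith) (pow_le_one₀ hl₂.le hl₂one.le)
  have hUzp : ∀ j : ℕ, ‖U j (zp j)‖ ≤ ‖U 0 a‖ + (Cp + M) := fun j => by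
    rcases j with _ | j
    · have h1 := (norm_nonneg _).trans (hCp 0)
      have h2 := (norm_nonneg _).trans (hM 0)
      simp only [Nat.cast_zero]
      exact le_add_of_nonneg_right (by linarith)
    · rw [hzp, Nat.cast_succ, map_add, ContinuousLinearEquiv.apply_symm_apply]
      exact (norm_add_le_of_le (hCp j) (hM j)).trans (le_add_of_nonneg_left (norm_nonneg _))
  set z : ℤ → H := fun n => if 0 ≤ n then zp n.toNat + b else zm (-n).toNat + a with hz
  have hzpos : ∀ j : ℕ, z j = zp j + b := fun j => by simp [hz]
  have hzneg : ∀ j : ℕ, z (-j) = zm j + a := fun j => by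
    rcases j with _ | j
    · simp [hz, a, b, add_comm]
    · rw [hz]
      dsimp only
      rw [if_neg (by omega), neg_neg, Int.toNat_natCast]
  have hzrec : ∀ n, z (n + 1) = z n + (U (n + 1)).symm (h n) := fun n => by
    rcases le_or_gt 0 n with hn | hn
    · lift n to ℕ using hn
      rw [hzpos, ← Nat.cast_succ, hzpos, hzp, Nat.cast_succ]
      abel
    · obtain ⟨j, rfl⟩ : ∃ j : ℕ, n = -((j + 1 : ℕ) : ℤ) := ⟨(-n - 1).toNat, by omega⟩
      have h1 : -((j + 1 : ℕ) : ℤ) + 1 = -(j : ℤ) := by push_cast; ring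
      have h2 : -((j + 1 : ℕ) : ℤ) = -(j : ℤ) - 1 := by push_cast; ring
      rw [hzneg, h1, hzneg, hzm, h2, map_neg]
      abel
  refine ⟨fun n => U n (z n), ⟨max (‖U 0 a‖ + (Cp + M) + k₁ * ‖b‖) (Cm + k₂ * ‖a‖),
    fun n => ?_⟩, fun n => ?_⟩
  · dsimp only
    obtain ⟨j, rfl | rfl⟩ := n.eq_nat_or_neg
    · rw [hzpos, map_add]
      exact (norm_add_le_of_le (hUzp j) (hUb j)).trans (le_max_left _ _)
    · rw [hzneg, map_add]
      exact (norm_add_le_of_le (hCm j) (hUa j)).trans (le_max_right _ _)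
  · dsimp only
    rw [hzrec, map_add, ContinuousLinearEquiv.apply_symm_apply]
    exact congrArg (fun T : H →L[ℂ] H => T (z n) + h n) (hUrec n)
end

section
/- (Corollary 1, e-dichotomy on the whole axis.) Assume in addition that P = Q. Then for every bounded sequence h : ℤ → H there exists a unique bounded sequence x : ℤ → H with x_{n+1} = Aₙ xₙ + hₙ for all n ∈ ℤ. -/
open Filter Topology

section

variable {H : Type*} [NormedAddCommGroup H] [NormedSpace ℂ H]

/-- Exponential estimates on the two half-axes for the same projector glue to an estimate on the
whole axis. -/
theorem norm_evolution_le_of_halfAxes (U : ℤ → H ≃L[ℂ] H) (P : H →L[ℂ] H) (hP : P ∘L P = P)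
    {k₁ l₁ k₂ l₂ : ℝ} (hk₁ : 1 ≤ k₁) (hl₁ : 0 < l₁) (hk₂ : 1 ≤ k₂) (hl₂ : 0 < l₂)
    (h₁ : ∀ m n : ℤ, 0 ≤ m → m ≤ n →
      ‖(U n : H →L[ℂ] H) ∘L P ∘L ((U m).symm : H →L[ℂ] H)‖ ≤ k₁ * l₁ ^ (n - m))
    (h₂ : ∀ m n : ℤ, n ≤ 0 → m ≤ n →
      ‖(U n : H →L[ℂ] H) ∘L P ∘L ((U m).symm : H →L[ℂ] H)‖ ≤ k₂ * l₂ ^ (n - m))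
    {m n : ℤ} (hmn : m ≤ n) :
    ‖(U n : H →L[ℂ] H) ∘L P ∘L ((U m).symm : H →L[ℂ] H)‖ ≤
      k₁ * k₂ * max l₁ l₂ ^ (n - m).natAbs := by
  have key₁ : ∀ m n : ℤ, 0 ≤ m → m ≤ n →
      ‖(U n : H →L[ℂ] H) ∘L P ∘L ((U m).symm : H →L[ℂ] H)‖ ≤
        k₁ * max l₁ l₂ ^ (n - m).natAbs := by
    intro m n hm hmn
    refine (h₁ m n hm hmn).trans ?_
    rw [← zpow_natCast, Int.natAbs_of_nonneg (sub_nonneg.2 hmn)]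
    exact mul_le_mul_of_nonneg_left
      (zpow_le_zpow_left₀ (sub_nonneg.2 hmn) hl₁.le (le_max_left _ _)) (by linarith)
  have key₂ : ∀ m n : ℤ, n ≤ 0 → m ≤ n →
      ‖(U n : H →L[ℂ] H) ∘L P ∘L ((U m).symm : H →L[ℂ] H)‖ ≤
        k₂ * max l₁ l₂ ^ (n - m).natAbs := by
    intro m n hm hmn
    refine (h₂ m n hm hmn).trans ?_
    rw [← zpow_natCast, Int.natAbs_of_nonneg (sub_nonneg.2 hmn)]
    exact mul_le_mul_of_nonneg_left
      (zpow_le_zpow_left₀ (sub_nonneg.2 hmn) hl₂.le (le_max_right _ _)) (by linarith)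
  have hl : 0 < max l₁ l₂ := lt_max_of_lt_left hl₁
  rcases le_total 0 m with hm | hm
  · refine (key₁ m n hm hmn).trans ?_
    gcongr
    nlinarith
  rcases le_total n 0 with hn | hn
  · refine (key₂ m n hn hmn).trans ?_
    gcongr
    nlinarith
  have hcomp : (U n : H →L[ℂ] H) ∘L P ∘L ((U m).symm : H →L[ℂ] H) =
      ((U n : H →L[ℂ] H) ∘L P ∘L ((U 0).symm : H →L[ℂ] H)) ∘L
        ((U 0 : H →L[ℂ] H) ∘L P ∘L ((U m).symm : H →L[ℂ] H)) := by
    ext v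
    have := DFunLike.congr_fun hP ((U m).symm v)
    simp only [ContinuousLinearMap.comp_apply] at this
    simp [this]
  rw [hcomp]
  refine (ContinuousLinearMap.opNorm_comp_le _ _).trans ?_
  refine (mul_le_mul (key₁ 0 n le_rfl hn) (key₂ m 0 le_rfl hm) (norm_nonneg _)
    (by positivity)).trans_eq ?_
  rw [show (n - m).natAbs = (n - 0).natAbs + (0 - m).natAbs by omega, pow_add]
  ring

theorem summable_pow_natAbs {l : ℝ} (hl : 0 ≤ l) (hl1 : l < 1) :
    Summable fun m : ℤ ↦ l ^ m.natAbs := by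
  apply Summable.of_nat_of_neg <;> simpa using summable_geometric_of_lt_one hl hl1

/-- The Green function of the inhomogeneous equation associated with the projector `P`. -/
noncomputable def greenFunction (U : ℤ → H ≃L[ℂ] H) (P : H →L[ℂ] H) (n m : ℤ) : H →L[ℂ] H :=
  if m ≤ n then (U n : H →L[ℂ] H) ∘L P ∘L ((U m).symm : H →L[ℂ] H)
  else -((U n : H →L[ℂ] H) ∘L (1 - P) ∘L ((U m).symm : H →L[ℂ] H))

theorem greenFunction_succ_apply {A : ℤ → H →L[ℂ] H} {U : ℤ → H ≃L[ℂ] H}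
    (hU : ∀ n v, U (n + 1) v = A n (U n v)) (P : H →L[ℂ] H) (n m : ℤ) (v : H) :
    greenFunction U P (n + 1) (m + 1) v =
      A n (greenFunction U P n (m + 1) v) + if m = n then v else 0 := by
  unfold greenFunction
  rcases lt_trichotomy m n with h | rfl | h
  · rw [if_pos (by omega), if_pos (by omega), if_neg h.ne]
    simp [hU]
  · rw [if_pos le_rfl, if_neg (by omega), if_pos rfl]
    have : A m (U m ((U (m + 1)).symm v)) = v := by rw [← hU]; simp
    simp [hU, this]
  · rw [if_neg (by omega), if_neg (by omega), if_neg h.ne']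
    simp [hU]

/-- A Green function with exponential decay yields a bounded solution for bounded data. -/
theorem exists_bounded_solution [CompleteSpace H] {A : ℤ → H →L[ℂ] H} {U : ℤ → H ≃L[ℂ] H}
    (hU : ∀ n v, U (n + 1) v = A n (U n v)) {P : H →L[ℂ] H} {K l : ℝ} (hl : 0 ≤ l) (hl1 : l < 1)
    (hG : ∀ n m, ‖greenFunction U P n m‖ ≤ K * l ^ (n - m).natAbs)
    {h : ℤ → H} {C : ℝ} (hC : ∀ n, ‖h n‖ ≤ C) :
    ∃ x : ℤ → H, (∃ C : ℝ, ∀ n, ‖x n‖ ≤ C) ∧ ∀ n, x (n + 1) = A n (x n) + h n := by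
  have hterm : ∀ n m, ‖greenFunction U P n (m + 1) (h m)‖ ≤
      K * C * l ^ (n - 1 - m).natAbs := by
    intro n m
    have h1 := hG n (m + 1)
    calc _ ≤ ‖greenFunction U P n (m + 1)‖ * ‖h m‖ := ContinuousLinearMap.le_opNorm _ _
      _ ≤ (K * l ^ (n - (m + 1)).natAbs) * C :=
        mul_le_mul h1 (hC m) (norm_nonneg _) ((norm_nonneg _).trans h1)
      _ = _ := by rw [show n - (m + 1) = n - 1 - m by ring]; ring
  have hgeom : ∀ n : ℤ, HasSum (fun m : ℤ ↦ K * C * l ^ (n - 1 - m).natAbs)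
      (K * C * ∑' m : ℤ, l ^ m.natAbs) := fun n ↦
    ((Equiv.subLeft (n - 1)).hasSum_iff.2 (summable_pow_natAbs hl hl1).hasSum).mul_left _
  have hsum : ∀ n, Summable fun m ↦ greenFunction U P n (m + 1) (h m) := fun n ↦
    Summable.of_norm_bounded (hgeom n).summable (hterm n)
  refine ⟨fun n ↦ ∑' m, greenFunction U P n (m + 1) (h m), ⟨_, fun n ↦
    tsum_of_norm_bounded (hgeom n) (hterm n)⟩, fun n ↦ ?_⟩
  have hstep := ((A n).hasSum (hsum n).hasSum).add (hasSum_ite_eq n (h n))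
  refine (hstep.congr_fun ?_).tsum_eq
  intro m
  rw [greenFunction_succ_apply hU]
  by_cases hmn : m = n <;> simp [hmn]

theorem eq_zero_of_norm_le_mul_pow {E : Type*} [NormedAddCommGroup E] {v : E}
    {c l : ℝ} (hl : 0 ≤ l) (hl1 : l < 1)
    (hv : ∀ n : ℕ, ‖v‖ ≤ c * l ^ n) : v = 0 := by
  have : Tendsto (fun n : ℕ ↦ c * l ^ n) atTop (𝓝 (c * 0)) :=
    (tendsto_pow_atTop_nhds_zero_of_lt_one hl hl1).const_mul c
  rw [mul_zero] at this
  exact norm_le_zero_iff.1 (ge_of_tendsto' this hv)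

/-- Under an exponential dichotomy on `ℤ`, the homogeneous equation has no nonzero bounded
solution. -/
theorem eq_zero_of_bounded_solution {A : ℤ → H →L[ℂ] H} {U : ℤ → H ≃L[ℂ] H}
    (hU : ∀ n v, U (n + 1) v = A n (U n v)) {P : H →L[ℂ] H} {K l : ℝ} (hl : 0 ≤ l) (hl1 : l < 1)
    (hG : ∀ n m, ‖greenFunction U P n m‖ ≤ K * l ^ (n - m).natAbs)
    {y : ℤ → H} {C : ℝ} (hC : ∀ n, ‖y n‖ ≤ C) (hy : ∀ n, y (n + 1) = A n (y n)) (n : ℤ) :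
    y n = 0 := by
  have hstep : ∀ n, (U (n + 1)).symm (y (n + 1)) = (U n).symm (y n) := by
    intro n
    rw [ContinuousLinearEquiv.symm_apply_eq, hU, ContinuousLinearEquiv.apply_symm_apply, hy]
  have hconst : ∀ m, (U m).symm (y m) = (U 0).symm (y 0) := by
    intro m
    induction m using Int.induction_on with
    | zero => rfl
    | succ i ih => rw [hstep, ih]
    | pred i ih => rw [← ih, ← hstep (-i - 1), sub_add_cancel]
  have hbound : ∀ m, ‖greenFunction U P n m (y m)‖ ≤ K * C * l ^ (n - m).natAbs := by
    intro m
    have h1 := hG n m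
    calc _ ≤ ‖greenFunction U P n m‖ * ‖y m‖ := ContinuousLinearMap.le_opNorm _ _
      _ ≤ (K * l ^ (n - m).natAbs) * C :=
        mul_le_mul h1 (hC m) (norm_nonneg _) ((norm_nonneg _).trans h1)
      _ = _ := by ring
  have hstable : U n (P ((U n).symm (y n))) = 0 := by
    refine eq_zero_of_norm_le_mul_pow (c := K * C) hl hl1 fun j ↦ ?_
    have h1 := hbound (n - j)
    rw [greenFunction, if_pos (by omega), show (n - (n - (j : ℤ))).natAbs = j by omega] at h1
    simpa [hconst (n - j), ← hconst n] using h1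
  have hunstable : U n ((1 - P) ((U n).symm (y n))) = 0 := by
    refine eq_zero_of_norm_le_mul_pow (c := K * C * l) hl hl1 fun j ↦ ?_
    have h1 := hbound (n + (j + 1))
    rw [greenFunction, if_neg (by omega),
      show (n - (n + ((j : ℤ) + 1))).natAbs = j + 1 by omega, pow_succ'] at h1
    rw [neg_apply, norm_neg, ← mul_assoc] at h1
    simpa only [ContinuousLinearMap.comp_apply, ContinuousLinearEquiv.coe_coe,
      hconst (n + (j + 1)), ← hconst n] using h1
  have hsplit : y n = U n (P ((U n).symm (y n))) + U n ((1 - P) ((U n).symm (y n))) := by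
    rw [← map_add]; simp
  rw [hsplit, hstable, hunstable, add_zero]

end


/- Corollary 1, e-dichotomy on the whole axis: if P = Q then for every bounded h there is a
   unique bounded solution on ℤ. -/
theorem e_dichotomy_whole_axis_unique_solution
    {H : Type*} [NormedAddCommGroup H] [InnerProductSpace ℂ H] [CompleteSpace H]
    (A : ℤ → H →L[ℂ] H) (hA : ∃ C : ℝ, ∀ n : ℤ, ‖A n‖ ≤ C)
    (U : ℤ → H ≃L[ℂ] H)
    (hU0 : (U 0 : H →L[ℂ] H) = 1)
    (hUrec : ∀ n : ℤ, ((U (n + 1) : H →L[ℂ] H)) = (A n) ∘L (U n : H →L[ℂ] H))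
    (P : H →L[ℂ] H) (hP : P ∘L P = P)
    (k₁ l₁ : ℝ) (hk₁ : 1 ≤ k₁) (hl₁ : 0 < l₁) (hl₁one : l₁ < 1)
    (hdich₁ : ∀ m n : ℤ, 0 ≤ m → m ≤ n →
      ‖(U n : H →L[ℂ] H) ∘L P ∘L ((U m).symm : H →L[ℂ] H)‖ ≤ k₁ * l₁ ^ (n - m))
    (hdich₁p : ∀ m n : ℤ, 0 ≤ n → n ≤ m →
      ‖(U n : H →L[ℂ] H) ∘L (1 - P) ∘L ((U m).symm : H →L[ℂ] H)‖ ≤ k₁ * l₁ ^ (m - n))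
    (Q : H →L[ℂ] H) (hQ : Q ∘L Q = Q)
    (k₂ l₂ : ℝ) (hk₂ : 1 ≤ k₂) (hl₂ : 0 < l₂) (hl₂one : l₂ < 1)
    (hdich₂ : ∀ m n : ℤ, n ≤ 0 → m ≤ n →
      ‖(U n : H →L[ℂ] H) ∘L Q ∘L ((U m).symm : H →L[ℂ] H)‖ ≤ k₂ * l₂ ^ (n - m))
    (hdich₂p : ∀ m n : ℤ, m ≤ 0 → n ≤ m →
      ‖(U n : H →L[ℂ] H) ∘L (1 - Q) ∘L ((U m).symm : H →L[ℂ] H)‖ ≤ k₂ * l₂ ^ (m - n))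
    (hPQ : P = Q) :
    ∀ h : ℤ → H, (∃ C : ℝ, ∀ n : ℤ, ‖h n‖ ≤ C) →
      ∃! x : ℤ → H, (∃ C : ℝ, ∀ n : ℤ, ‖x n‖ ≤ C) ∧ ∀ n : ℤ, x (n + 1) = A n (x n) + h n := by
  subst hPQ
  rintro h ⟨C, hC⟩
  have hU : ∀ n v, U (n + 1) v = A n (U n v) := fun n v ↦ DFunLike.congr_fun (hUrec n) v
  have hl : 0 ≤ max l₁ l₂ := hl₁.le.trans (le_max_left _ _)
  have hl1 : max l₁ l₂ < 1 := max_lt hl₁one hl₂one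
  have hP' : (1 - P) ∘L (1 - P) = 1 - P := IsIdempotentElem.one_sub (a := P) hP
  have hG : ∀ n m, ‖greenFunction U P n m‖ ≤ k₁ * k₂ * max l₁ l₂ ^ (n - m).natAbs := by
    intro n m
    unfold greenFunction
    split_ifs with hmn
    · exact norm_evolution_le_of_halfAxes U P hP hk₁ hl₁ hk₂ hl₂ hdich₁ hdich₂ hmn
    · have := norm_evolution_le_of_halfAxes (fun n ↦ U (-n)) (1 - P) hP' hk₂ hl₂ hk₁ hl₁
        (fun m n hm hn ↦ by
          simpa [sub_eq_add_neg, add_comm] using hdich₂p (-m) (-n) (by omega) (by omega))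
        (fun m n hm hn ↦ by
          simpa [sub_eq_add_neg, add_comm] using hdich₁p (-m) (-n) (by omega) (by omega))
        (m := -m) (n := -n) (by omega)
      rw [norm_neg, mul_comm k₁, max_comm, show (n - m).natAbs = (-n - -m).natAbs by omega]
      simpa only [neg_neg] using this
  obtain ⟨x, ⟨B, hB⟩, hx⟩ := exists_bounded_solution hU hl hl1 hG hC
  refine ⟨x, ⟨⟨B, hB⟩, hx⟩, ?_⟩
  rintro y ⟨⟨D, hD⟩, hy⟩
  funext n
  refine sub_eq_zero.1 (eq_zero_of_bounded_solution (y := fun n ↦ y n - x n) hU hl hl1 hG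
    (C := D + B) (fun n ↦ (norm_sub_le _ _).trans (add_le_add (hD n) (hB n))) (fun n ↦ ?_) n)
  simp only [hy, hx, map_sub]
  abel
end

section
/- (Corollary 2, Moore–Penrose self-pseudoinverse.) Let P and Q be orthogonal projections on H (bounded, self-adjoint, idempotent) with PQ = QP, and set D := P − (I − Q). Then D is self-adjoint, D D D = D, and D is its own Moore–Penrose pseudoinverse, i.e. with X := D all four Moore–Penrose equations hold: D X D = D, X D X = X, (D X)* = D X, and (X D)* = X D. -/
/-- The difference of two commuting idempotents is equal to its own cube. -/
theorem Commute.sub_mul_sub_mul_sub_of_isIdempotentElem {R : Type*} [Ring R] {p r : R}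
    (h : Commute p r) (hp : IsIdempotentElem p) (hr : IsIdempotentElem r) :
    (p - r) * ((p - r) * (p - r)) = p - r := by
  have hsq : (p - r) * (p - r) = p - p * r - p * r + r := by
    rw [mul_sub, sub_mul, sub_mul, hp.eq, hr.eq, ← h.eq]
    abel
  have hppr : p * (p * r) = p * r := by rw [← mul_assoc, hp.eq]
  have hrpr : r * (p * r) = p * r := by rw [← mul_assoc, ← h.eq, mul_assoc, hr.eq]
  rw [hsq]
  simp only [sub_mul, mul_add, mul_sub, hp.eq, hr.eq, hppr, hrpr, ← h.eq]
  abel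

/- Corollary 2, Moore–Penrose self-pseudoinverse: for commuting orthogonal projections P, Q
   and D = P − (I − Q), D is self-adjoint, DDD = D, and X := D satisfies the four
   Moore–Penrose equations. -/
theorem commuting_orthogonal_projections_moore_penrose
    {H : Type*} [NormedAddCommGroup H] [InnerProductSpace ℂ H] [CompleteSpace H]
    (P Q : H →L[ℂ] H)
    (hP : P ∘L P = P) (hQ : Q ∘L Q = Q)
    (hPsa : ContinuousLinearMap.adjoint P = P) (hQsa : ContinuousLinearMap.adjoint Q = Q)
    (hcomm : P ∘L Q = Q ∘L P)
    (D : H →L[ℂ] H) (hD : D = P - (1 - Q)) :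
    ContinuousLinearMap.adjoint D = D ∧
    D ∘L D ∘L D = D ∧
    ∃ X : H →L[ℂ] H, X = D ∧
      D ∘L X ∘L D = D ∧ X ∘L D ∘L X = X ∧
      ContinuousLinearMap.adjoint (D ∘L X) = D ∘L X ∧
      ContinuousLinearMap.adjoint (X ∘L D) = X ∘L D := by
  have hself : ContinuousLinearMap.adjoint D = D := by
    rw [hD, map_sub, map_sub, hPsa, hQsa, ContinuousLinearMap.one_def,
      ContinuousLinearMap.adjoint_id]
  have hcube : D ∘L D ∘L D = D := by
    rw [hD]
    have hPQ : Commute P Q := hcomm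
    have hQidem : IsIdempotentElem Q := hQ
    exact ((Commute.one_right P).sub_right hPQ).sub_mul_sub_mul_sub_of_isIdempotentElem
      hP hQidem.one_sub
  have hsq : ContinuousLinearMap.adjoint (D ∘L D) = D ∘L D := by
    rw [ContinuousLinearMap.adjoint_comp, hself]
  exact ⟨hself, hcube, D, rfl, hcube, hcube, hsq, hsq⟩
end
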